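/- arXiv:1706.04773 — 3 statements merged into one kernel-verified Lean document; each statement's English description precedes it below -/
import Mathlib

section
/- Let μ be a semifinite nonatomic Borel measure on a compactum X. Let G ⊆ [0,1] be a copy of the irrationals that is dense in [0,1] and satisfies λ(G) = 0, and let U be a nonempty relatively open subset of G. Let G' ⊆ X be a copy of the irrationals with μ(G') = 0, and let U' be a nonempty relatively open subset of G' with μ(cl(U') \ G') > 0 (closure in X). Let L ⊆ cl(U) \ U be a Cantor set with λ(L) > 0 (closure in [0,1]). Then there exist a Cantor set L' ⊆ cl(U') \ U' and a homeomorphism g : U ∪ L → U' ∪ L' such that g(L) = L', μ(L') > 0, and there is a constant c > 0 with μ(g(A)) = c·λ(A) for every Borel set A ⊆ L; in particular, for every A ⊆ L, λ(A) = 0 if and only if μ(g(A)) = 0. -/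
open MeasureTheory Topology Filter Set ENNReal

/-- `μ` is semifinite: every Borel set of positive measure contains a Borel subset of
finite positive measure. -/
def Semifinite {X : Type*} [MeasurableSpace X] (μ : Measure X) : Prop :=
  ∀ A : Set X, MeasurableSet A → 0 < μ A →
    ∃ B ⊆ A, MeasurableSet B ∧ 0 < μ B ∧ μ B < ⊤

lemma baire_len (P : Set (ℕ → ℕ) → Prop) (V : Set (ℕ → ℕ))
    (hV : ∀ y ∈ V, ∃ n, P (PiNat.cylinder y n)) :
    ∃ m : (ℕ → ℕ) → ℕ, (∀ y ∈ V, P (PiNat.cylinder y (m y))) ∧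
      ∀ y ∈ V, ∀ z ∈ PiNat.cylinder y (m y), m z = m y := by
  refine ⟨fun y => sInf {n | P (PiNat.cylinder y n)}, fun y hy => Nat.sInf_mem (hV y hy), ?_⟩
  intro y hy z hz
  have hP : P (PiNat.cylinder y (sInf {n | P (PiNat.cylinder y n)})) := Nat.sInf_mem (hV y hy)
  have hle : ∀ k ≤ sInf {n | P (PiNat.cylinder y n)},
      PiNat.cylinder z k = PiNat.cylinder y k := fun k hk =>
    PiNat.mem_cylinder_iff_eq.1 (PiNat.cylinder_anti y hk hz)
  have hz' : P (PiNat.cylinder z (sInf {n | P (PiNat.cylinder y n)})) := by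
    rw [hle _ le_rfl]; exact hP
  have h1 : sInf {n | P (PiNat.cylinder z n)} ≤ sInf {n | P (PiNat.cylinder y n)} :=
    Nat.sInf_le hz'
  refine le_antisymm h1 (Nat.sInf_le ?_)
  have h2 : P (PiNat.cylinder z (sInf {n | P (PiNat.cylinder z n)})) :=
    Nat.sInf_mem (s := {n | P (PiNat.cylinder z n)}) ⟨_, hz'⟩
  rw [hle _ h1] at h2
  exact h2

lemma open_cylinder {V : Set (ℕ → ℕ)} (hV : IsOpen V) {y : ℕ → ℕ} (hy : y ∈ V) :
    ∃ n, PiNat.cylinder y n ⊆ V := by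
  obtain ⟨v, ⟨x, n, rfl⟩, hyv, hsub⟩ :=
    (PiNat.isTopologicalBasis_cylinders (fun _ : ℕ => ℕ)).exists_subset_of_mem_open hy hV
  exact ⟨n, by rw [PiNat.mem_cylinder_iff_eq.1 hyv]; exact hsub⟩

lemma baire_select {ι : Type*} (O : ι → Set (ℕ → ℕ)) (hO : ∀ i, IsOpen (O i))
    (hcov : ∀ y, ∃ i, y ∈ O i) :
    ∃ i : (ℕ → ℕ) → ι, IsLocallyConstant i ∧ ∀ y, y ∈ O (i y) := by
  classical
  obtain ⟨m, hm1, hm2⟩ := baire_len (fun C => ∃ i, C ⊆ O i) univ (fun y _ => by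
    obtain ⟨i, hi⟩ := hcov y
    obtain ⟨n, hn⟩ := open_cylinder (hO i) hi
    exact ⟨n, i, hn⟩)
  have hι : Nonempty ι := ⟨(hcov (fun _ => 0)).choose⟩
  have : ∃ j : Set (ℕ → ℕ) → ι, ∀ C, (∃ i, C ⊆ O i) → C ⊆ O (j C) := by
    refine ⟨fun C => if h : ∃ i, C ⊆ O i then h.choose else hι.some, fun C h => ?_⟩
    simp only [h, dif_pos]
    exact h.choose_spec
  obtain ⟨j, hj⟩ := this
  refine ⟨fun y => j (PiNat.cylinder y (m y)), ?_, fun y =>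
    hj _ (hm1 y (mem_univ _)) (PiNat.self_mem_cylinder _ _)⟩
  rw [IsLocallyConstant.iff_exists_open]
  intro y
  refine ⟨PiNat.cylinder y (m y), PiNat.isOpen_cylinder _ _ _, PiNat.self_mem_cylinder _ _, ?_⟩
  intro z hz
  rw [hm2 y (mem_univ _) z hz, PiNat.mem_cylinder_iff_eq.1 hz]

/-- Prepending a digit. -/
def baireCons : (ℕ × (ℕ → ℕ)) ≃ₜ (ℕ → ℕ) where
  toFun p := fun n => Nat.casesOn n p.1 p.2
  invFun y := (y 0, fun n => y (n + 1))
  left_inv p := rfl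
  right_inv y := by funext n; cases n <;> rfl
  continuous_toFun := by
    refine continuous_pi fun n => ?_
    cases n with
    | zero => exact continuous_fst
    | succ n => exact (continuous_apply n).comp continuous_snd
  continuous_invFun := by fun_prop

lemma baire_open {V : Set (ℕ → ℕ)} (hV : IsOpen V) (hne : V.Nonempty) :
    Nonempty (V ≃ₜ (ℕ → ℕ)) := by
  classical
  obtain ⟨m, hm1, hm2⟩ := baire_len (fun C => C ⊆ V) V (fun y hy => open_cylinder hV hy)
  set r : (ℕ → ℕ) → (ℕ → ℕ) := fun y n => if n < m y then y n else 0 with hr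
  have hrmem : ∀ y, r y ∈ PiNat.cylinder y (m y) := by
    intro y i hi
    simp [hr, hi]
  have hreq : ∀ y ∈ V, ∀ z ∈ PiNat.cylinder y (m y), r z = r y := by
    intro y hy z hz
    funext n
    simp only [hr, hm2 y hy z hz]
    split_ifs with h
    · exact hz n h
    · rfl
  set S : Set (ℕ → ℕ) := r '' V with hS
  have hSV : ∀ s ∈ S, s ∈ V ∧ r s = s := by
    rintro _ ⟨y, hy, rfl⟩
    exact ⟨hm1 y hy (hrmem y), hreq y hy _ (hrmem y)⟩
  have hdisc : DiscreteTopology S := by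
    rw [discreteTopology_iff_isOpen_singleton]
    rintro ⟨s, hs⟩
    have : ({⟨s, hs⟩} : Set S) = Subtype.val ⁻¹' (PiNat.cylinder s (m s)) := by
      ext ⟨t, ht⟩
      simp only [mem_singleton_iff, Subtype.mk.injEq, mem_preimage]
      constructor
      · rintro rfl; exact PiNat.self_mem_cylinder _ _
      · intro h
        rw [← (hSV t ht).2, ← (hSV s hs).2]
        exact hreq s (hSV s hs).1 t h
    rw [this]
    exact (PiNat.isOpen_cylinder _ _ _).preimage continuous_subtype_val
  have hcount : Countable S := by
    have hinj : Function.Injective (fun s : S => (⟨m s.1, fun i => s.1 i⟩ : Σ n, Fin n → ℕ)) := by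
      rintro ⟨s, hs⟩ ⟨t, ht⟩ h
      have h1 : m s = m t := congrArg Sigma.fst h
      have h2 : ∀ i < m s, s i = t i := by
        intro i hi
        have := congrArg (fun p : Σ n, Fin n → ℕ => if h : i < p.1 then p.2 ⟨i, h⟩ else 0) h
        simpa [hi, h1 ▸ hi] using this
      apply Subtype.ext
      show s = t
      rw [← (hSV t ht).2, ← (hSV s hs).2]
      funext n
      simp only [hr, h1]
      split_ifs with hn
      · exact h2 n (h1 ▸ hn)
      · rfl
    exact hinj.countable
  have hSne : Nonempty S := ⟨⟨r hne.some, hne.some, hne.some_mem, rfl⟩⟩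
  have hjm : ∀ (s : S) (z : ℕ → ℕ), (fun k => if k < m s.1 then s.1 k else z (k - m s.1)) ∈
      PiNat.cylinder s.1 (m s.1) := by
    intro s z i hi
    simp [hi]
  let e : V ≃ₜ S × (ℕ → ℕ) :=
    { toFun := fun y => (⟨r y.1, y.1, y.2, rfl⟩, fun n => y.1 (n + m y.1))
      invFun := fun p => ⟨fun k => if k < m p.1.1 then p.1.1 k else p.2 (k - m p.1.1),
        hm1 _ (hSV _ p.1.2).1 (hjm p.1 p.2)⟩
      left_inv := by
        rintro ⟨y, hy⟩
        apply Subtype.ext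
        funext k
        have : m (r y) = m y := hm2 y hy _ (hrmem y)
        simp only [this]
        split_ifs with h
        · simp [hr, h]
        · congr 1; omega
      right_inv := by
        rintro ⟨s, z⟩
        have h1 := hreq _ (hSV _ s.2).1 _ (hjm s z)
        have h2 := hm2 _ (hSV _ s.2).1 _ (hjm s z)
        refine Prod.ext (Subtype.ext ?_) ?_
        · exact h1.trans (hSV _ s.2).2
        · funext n
          simp only [h2]
          simp
      continuous_toFun := by
        rw [continuous_iff_continuousAt]
        rintro ⟨y, hy⟩
        have hn : ∀ᶠ z : V in 𝓝 ⟨y, hy⟩, z.1 ∈ PiNat.cylinder y (m y) :=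
          ((PiNat.isOpen_cylinder _ _ _).preimage continuous_subtype_val).mem_nhds
            (PiNat.self_mem_cylinder _ _)
        have : ContinuousAt (fun z : V => ((⟨r y, y, hy, rfl⟩ : S), fun n => z.1 (n + m y)))
            ⟨y, hy⟩ := by
          apply Continuous.continuousAt
          refine continuous_const.prodMk (continuous_pi fun n => ?_)
          exact (continuous_apply _).comp continuous_subtype_val
        refine this.congr ?_
        filter_upwards [hn] with z hz
        refine Prod.ext (Subtype.ext ?_) ?_
        · exact (hreq y hy _ hz).symm
        · simp only [hm2 y hy _ hz]
      continuous_invFun := by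
        rw [continuous_prod_of_discrete_left]
        intro s
        refine Continuous.subtype_mk ?_ _
        refine continuous_pi fun n => ?_
        simp only
        split_ifs
        · exact continuous_const
        · exact continuous_apply _ }
  obtain ⟨den⟩ := nonempty_denumerable (S × ℕ)
  refine ⟨e.trans (((Homeomorph.refl S).prodCongr baireCons.symm).trans
    ((Homeomorph.prodAssoc _ _ _).symm.trans
    (((Denumerable.eqv (S × ℕ)).toHomeomorphOfDiscrete.prodCongr (Homeomorph.refl _)).trans
      baireCons)))⟩

lemma match_seq {Z : Type*} [PseudoMetricSpace Z] (a b : ℕ → Z)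
    (hab : ∀ n, ∀ ε > 0, ∃ᶠ k in atTop, dist (a n) (b k) < ε)
    (hba : ∀ n, ∀ ε > 0, ∃ᶠ k in atTop, dist (a k) (b n) < ε) :
    ∃ σ : ℕ ≃ ℕ, Tendsto (fun n => dist (a n) (b (σ n))) atTop (𝓝 0) := by
  obtain ⟨f, hf, hf'⟩ := extraction_forall_of_frequently
    (fun n : ℕ => hab n (1 / ((n : ℝ) + 1)) (by positivity))
  obtain ⟨g, hg, hg'⟩ := extraction_forall_of_frequently
    (fun n : ℕ => hba n (1 / ((n : ℝ) + 1)) (by positivity))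
  obtain ⟨s, hs, hsR⟩ := Function.Embedding.schroeder_bernstein_of_rel hf.injective hg.injective
    (fun n k => dist (a n) (b k) < 1 / (((min n k : ℕ) : ℝ) + 1))
    (fun n => by rw [min_eq_left hf.le_apply]; exact hf' n)
    (fun n => by rw [min_eq_right hg.le_apply]; exact hg' n)
  refine ⟨Equiv.ofBijective s hs, ?_⟩
  have hst : Tendsto s atTop atTop := by
    rw [← Nat.cofinite_eq_atTop]; exact hs.1.tendsto_cofinite
  have hmin : Tendsto (fun n => min n (s n)) atTop atTop := by
    rw [tendsto_atTop]
    intro K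
    filter_upwards [eventually_ge_atTop K, hst.eventually_ge_atTop K] with n h1 h2
    exact le_min h1 h2
  refine squeeze_zero (fun n => dist_nonneg) (fun n => (hsR n).le) ?_
  exact tendsto_one_div_add_atTop_nhds_zero_nat.comp hmin

/-- A homeomorphism between two sets, presented by globally defined functions. -/
structure SetHomeo {Y Y' : Type*} [TopologicalSpace Y] [TopologicalSpace Y']
    (f : Y → Y') (f' : Y' → Y) (A : Set Y) (B : Set Y') : Prop where
  mapsTo : MapsTo f A B
  mapsTo' : MapsTo f' B A
  left : ∀ x ∈ A, f' (f x) = x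
  right : ∀ x ∈ B, f (f' x) = x
  cont : ContinuousOn f A
  cont' : ContinuousOn f' B

lemma SetHomeo.symm {Y Y' : Type*} [TopologicalSpace Y] [TopologicalSpace Y']
    {f : Y → Y'} {f' : Y' → Y} {A : Set Y} {B : Set Y'} (h : SetHomeo f f' A B) :
    SetHomeo f' f B A :=
  ⟨h.mapsTo', h.mapsTo, h.right, h.left, h.cont', h.cont⟩

lemma continuousOn_dite {Y Y' : Type*} [TopologicalSpace Y] [TopologicalSpace Y']
    {A : Set Y} {B : Set Y'} (e : A → B) (he : Continuous e) (b : Y') [∀ x, Decidable (x ∈ A)] :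
    ContinuousOn (fun x => if h : x ∈ A then (e ⟨x, h⟩ : Y') else b) A := by
  rw [continuousOn_iff_continuous_domRestrict]
  have : A.domRestrict (fun x => if h : x ∈ A then (e ⟨x, h⟩ : Y') else b) =
      fun x => (e x : Y') := by
    funext x
    simp [Set.domRestrict]
  rw [this]
  exact continuous_subtype_val.comp he

lemma SetHomeo.of_homeo {Y Y' : Type*} [TopologicalSpace Y] [TopologicalSpace Y']
    {A : Set Y} {B : Set Y'} (e : A ≃ₜ B) (hA : A.Nonempty) :
    ∃ f f', SetHomeo f f' A B ∧ ∀ x : A, f x = e x := by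
  classical
  obtain ⟨a, ha⟩ := hA
  refine ⟨fun x => if h : x ∈ A then (e ⟨x, h⟩ : Y') else (e ⟨a, ha⟩ : Y'),
    fun x => if h : x ∈ B then (e.symm ⟨x, h⟩ : Y) else a, ⟨?_, ?_, ?_, ?_, ?_, ?_⟩, ?_⟩
  · intro x hx; simp [hx]
  · intro x hx; simp [hx]
  · intro x hx; simp [hx]
  · intro x hx; simp [hx]
  · exact continuousOn_dite e e.continuous _
  · exact continuousOn_dite e.symm e.symm.continuous _
  · intro x; simp

lemma SetHomeo.toHomeo {Y Y' : Type*} [TopologicalSpace Y] [TopologicalSpace Y']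
    {f : Y → Y'} {f' : Y' → Y} {A : Set Y} {B : Set Y'} (h : SetHomeo f f' A B) :
    ∃ e : A ≃ₜ B, ∀ x : A, (e x : Y') = f x :=
  ⟨{ toFun := fun x => ⟨f x, h.mapsTo x.2⟩
     invFun := fun x => ⟨f' x, h.mapsTo' x.2⟩
     left_inv := fun x => Subtype.ext (h.left x x.2)
     right_inv := fun x => Subtype.ext (h.right x x.2)
     continuous_toFun := (continuousOn_iff_continuous_domRestrict.1 h.cont).subtype_mk _
     continuous_invFun := (continuousOn_iff_continuous_domRestrict.1 h.cont').subtype_mk _ },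
    fun _ => rfl⟩

/-- A partition of `U` into nonempty relatively clopen pieces (fibers of `i`) shrinking to `C`. -/
structure ShrinkPart {Y : Type*} [MetricSpace Y] (U C : Set Y) (i : Y → ℕ) (x : ℕ → Y) : Prop where
  ne : ∀ n, ∃ y ∈ U, i y = n
  loc : ∀ y ∈ U, ∀ᶠ z in 𝓝[U] y, i z = i y
  far : ∀ n, ∃ δ > 0, ∀ y ∈ U, i y = n → ∀ c ∈ C, δ ≤ dist y c
  mem : ∀ n, x n ∈ C
  near : ∀ ε > 0, ∀ᶠ n in atTop, ∀ y ∈ U, i y = n → dist y (x n) < ε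

lemma ShrinkPart.far_lt {Y : Type*} [MetricSpace Y] {U C : Set Y} {i : Y → ℕ} {x : ℕ → Y}
    (h : ShrinkPart U C i x) (K : ℕ) :
    ∃ δ > 0, ∀ y ∈ U, ∀ c ∈ C, dist y c < δ → K ≤ i y := by
  induction K with
  | zero => exact ⟨1, one_pos, fun _ _ _ _ _ => Nat.zero_le _⟩
  | succ K ih =>
    obtain ⟨δ, hδ, h1⟩ := ih
    obtain ⟨δ', hδ', h2⟩ := h.far K
    refine ⟨min δ δ', lt_min hδ hδ', fun y hy c hc hd => ?_⟩
    have h3 := h1 y hy c hc (hd.trans_le (min_le_left _ _))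
    refine lt_of_le_of_ne h3 (fun he => ?_)
    exact absurd (h2 y hy he.symm c hc) (not_le.2 (hd.trans_le (min_le_right _ _)))

lemma ShrinkPart.freq {Y : Type*} [MetricSpace Y] {U C : Set Y} {i : Y → ℕ} {x : ℕ → Y}
    (h : ShrinkPart U C i x) (hC : C ⊆ closure U) {c : Y} (hc : c ∈ C) {ε : ℝ} (hε : 0 < ε) :
    ∃ᶠ n in atTop, dist c (x n) < ε := by
  rw [frequently_atTop]
  intro N
  obtain ⟨K, hK⟩ := eventually_atTop.1 (h.near (ε / 2) (half_pos hε))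
  obtain ⟨δ, hδ, h1⟩ := h.far_lt (max N K)
  obtain ⟨y, hy, hyc⟩ := Metric.mem_closure_iff.1 (hC hc) (min δ (ε / 2))
    (lt_min hδ (half_pos hε))
  have h2 := h1 y hy c hc (by rw [dist_comm]; exact hyc.trans_le (min_le_left _ _))
  refine ⟨i y, (le_max_left _ _).trans h2, ?_⟩
  have h3 := hK (i y) ((le_max_right _ _).trans h2) y hy rfl
  have h4 := hyc.trans_le (min_le_right _ _)
  have := dist_triangle c y (x (i y))
  linarith

lemma glue_cont {Y Y' : Type*} [MetricSpace Y] [MetricSpace Y'] {U C : Set Y} {U' C' : Set Y'}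
    {i : Y → ℕ} {x : ℕ → Y} {i' : Y' → ℕ} {x' : ℕ → Y'}
    (hS : ShrinkPart U C i x) (hS' : ShrinkPart U' C' i' x') (hC : IsClosed C)
    (σ : ℕ ≃ ℕ) (h : Y → Y') (hh : ContinuousOn h C)
    (hσ : Tendsto (fun n => dist (h (x n)) (x' (σ n))) atTop (𝓝 0))
    (f : ℕ → Y → Y') (hfm : ∀ n, MapsTo (f n) {y ∈ U | i y = n} {y ∈ U' | i' y = σ n})
    (hfc : ∀ n, ContinuousOn (f n) {y ∈ U | i y = n}) [∀ y, Decidable (y ∈ C)] :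
    ContinuousOn (fun y => if y ∈ C then h y else f (i y) y) (U ∪ C) := by
  intro y hy
  by_cases hyC : y ∈ C
  · rw [Metric.continuousWithinAt_iff]
    intro ε hε
    obtain ⟨δ₁, hδ₁, h1⟩ := Metric.continuousOn_iff.1 hh y hyC (ε / 3) (by positivity)
    have hσt : Tendsto σ atTop atTop := by
      rw [← Nat.cofinite_eq_atTop]; exact σ.injective.tendsto_cofinite
    have hev := (hS.near (δ₁ / 2) (half_pos hδ₁)).and
      ((hσt.eventually (hS'.near (ε / 3) (by positivity))).and
        (hσ.eventually (gt_mem_nhds (show (0 : ℝ) < ε / 3 by positivity))))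
    obtain ⟨K, hK⟩ := eventually_atTop.1 hev
    obtain ⟨δ₂, hδ₂, h2⟩ := hS.far_lt K
    refine ⟨min (δ₁ / 2) δ₂, lt_min (half_pos hδ₁) hδ₂, ?_⟩
    intro z hz hzy
    simp only [hyC, if_true]
    by_cases hzC : z ∈ C
    · simp only [hzC, if_true]
      have := h1 z hzC (by have := hzy.trans_le (min_le_left _ _); linarith)
      linarith
    · simp only [hzC, if_false]
      have hzU : z ∈ U := hz.resolve_right hzC
      obtain ⟨e1, e2, e3⟩ := hK (i z) (h2 z hzU y hyC (hzy.trans_le (min_le_right _ _)))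
      have e4 := e1 z hzU rfl
      obtain ⟨m1, m2⟩ := hfm (i z) ⟨hzU, rfl⟩
      have e5 := e2 _ m1 m2
      have e6 := h1 (x (i z)) (hS.mem _) (by
        have a1 := hzy.trans_le (min_le_left _ _)
        have a2 := dist_triangle_left (x (i z)) y z
        linarith)
      have t1 := dist_triangle (f (i z) z) (x' (σ (i z))) (h y)
      have t2 := dist_triangle_left (x' (σ (i z))) (h y) (h (x (i z)))
      linarith
  · have hyU : y ∈ U := hy.resolve_right hyC
    have hev : ∀ᶠ z in 𝓝[U ∪ C] y, z ∉ C :=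
      mem_nhdsWithin_of_mem_nhds (hC.isOpen_compl.mem_nhds hyC)
    have hev2 : ∀ᶠ z in 𝓝[U ∪ C] y, z ∈ U ∧ i z = i y := by
      have h3 : ∀ᶠ z in 𝓝 y, z ∈ U → i z = i y := eventually_nhdsWithin_iff.1 (hS.loc y hyU)
      filter_upwards [hev, mem_nhdsWithin_of_mem_nhds h3, self_mem_nhdsWithin] with z a1 a2 a3
      have := a3.resolve_right a1
      exact ⟨this, a2 this⟩
    have hc : ContinuousWithinAt (f (i y)) (U ∪ C) y :=
      (hfc (i y) y ⟨hyU, rfl⟩).mono_of_mem_nhdsWithin hev2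
    refine hc.congr_of_eventuallyEq ?_ (by simp [hyC])
    filter_upwards [hev, hev2] with z a1 a2
    simp [a1, a2.2]

lemma glue {Y Y' : Type*} [MetricSpace Y] [MetricSpace Y'] {U C : Set Y} {U' C' : Set Y'}
    {i : Y → ℕ} {x : ℕ → Y} {i' : Y' → ℕ} {x' : ℕ → Y'}
    (hS : ShrinkPart U C i x) (hS' : ShrinkPart U' C' i' x') (hC : IsCompact C) (hC' : IsCompact C')
    (hd : Disjoint U C) (hd' : Disjoint U' C') (hcl : C ⊆ closure U) (hcl' : C' ⊆ closure U')
    (hpc : ∀ n, Nonempty ({y ∈ U | i y = n} ≃ₜ (ℕ → ℕ)))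
    (hpc' : ∀ n, Nonempty ({y ∈ U' | i' y = n} ≃ₜ (ℕ → ℕ)))
    {h : Y → Y'} {h' : Y' → Y} (hh : SetHomeo h h' C C') :
    ∃ g g', SetHomeo g g' (U ∪ C) (U' ∪ C') ∧ ∀ y ∈ C, g y = h y := by
  classical
  obtain ⟨σ, hσ⟩ := match_seq (fun n => h (x n)) x'
    (fun n ε hε => hS'.freq hcl' (hh.mapsTo (hS.mem n)) hε)
    (fun n ε hε => by
      have hm : h' (x' n) ∈ C := hh.mapsTo' (hS'.mem n)
      obtain ⟨δ, hδ, h1⟩ := Metric.continuousOn_iff.1 hh.cont _ hm ε hε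
      refine (hS.freq hcl hm hδ).mono fun k hk => ?_
      have := h1 _ (hS.mem k) (by rw [dist_comm]; exact hk)
      rwa [hh.right _ (hS'.mem n)] at this)
  have hσ' : Tendsto (fun m => dist (h' (x' m)) (x (σ.symm m))) atTop (𝓝 0) := by
    have hst : Tendsto σ.symm atTop atTop := by
      rw [← Nat.cofinite_eq_atTop]; exact σ.symm.injective.tendsto_cofinite
    have huc := hC'.uniformContinuousOn_of_continuous hh.cont'
    rw [Metric.uniformContinuousOn_iff] at huc
    rw [Metric.tendsto_atTop]
    intro ε hε
    obtain ⟨δ, hδ, h1⟩ := huc ε hε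
    have := hst.eventually (hσ.eventually (gt_mem_nhds hδ))
    obtain ⟨N, hN⟩ := eventually_atTop.1 this
    refine ⟨N, fun m hm => ?_⟩
    have h2 := hN m hm
    simp only [Equiv.apply_symm_apply] at h2
    have h3 := h1 _ (hS'.mem m) _ (hh.mapsTo (hS.mem (σ.symm m))) (by rw [dist_comm]; exact h2)
    rw [hh.left _ (hS.mem _)] at h3
    simpa using h3
  have hex : ∀ n, ∃ f f', SetHomeo f f' {y ∈ U | i y = n} {y ∈ U' | i' y = σ n} := by
    intro n
    obtain ⟨e⟩ := hpc n
    obtain ⟨e'⟩ := hpc' (σ n)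
    obtain ⟨f, f', hf, -⟩ := SetHomeo.of_homeo (e.trans e'.symm) (hS.ne n)
    exact ⟨f, f', hf⟩
  choose f f' hf using hex
  refine ⟨fun y => if y ∈ C then h y else f (i y) y,
    fun y => if y ∈ C' then h' y else f' (σ.symm (i' y)) y, ⟨?_, ?_, ?_, ?_, ?_, ?_⟩, ?_⟩
  · intro y hy
    by_cases hyC : y ∈ C
    · simp only [hyC, if_true]; exact Or.inr (hh.mapsTo hyC)
    · simp only [hyC, if_false]
      exact Or.inl ((hf (i y)).mapsTo ⟨hy.resolve_right hyC, rfl⟩).1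
  · intro y hy
    by_cases hyC : y ∈ C'
    · simp only [hyC, if_true]; exact Or.inr (hh.mapsTo' hyC)
    · simp only [hyC, if_false]
      exact Or.inl ((hf (σ.symm (i' y))).mapsTo' ⟨hy.resolve_right hyC, by simp⟩).1
  · intro y hy
    by_cases hyC : y ∈ C
    · simp only [hyC, if_true, hh.mapsTo hyC]; exact hh.left y hyC
    · have hyU := hy.resolve_right hyC
      have hm := (hf (i y)).mapsTo ⟨hyU, rfl⟩
      have hn : f (i y) y ∉ C' := fun hc => hd'.le_bot ⟨hm.1, hc⟩
      simp only [hyC, if_false, hn, hm.2, Equiv.symm_apply_apply]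
      exact (hf (i y)).left y ⟨hyU, rfl⟩
  · intro y hy
    by_cases hyC : y ∈ C'
    · simp only [hyC, if_true, hh.mapsTo' hyC]; exact hh.right y hyC
    · have hyU := hy.resolve_right hyC
      have hyM : y ∈ {y ∈ U' | i' y = σ (σ.symm (i' y))} := ⟨hyU, by simp⟩
      have hm := (hf (σ.symm (i' y))).mapsTo' hyM
      have hn : f' (σ.symm (i' y)) y ∉ C := fun hc => hd.le_bot ⟨hm.1, hc⟩
      simp only [hyC, if_false, hn, hm.2]
      exact (hf _).right y hyM
  · exact glue_cont hS hS' hC.isClosed σ h hh.cont hσ f (fun n => (hf n).mapsTo)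
      (fun n => (hf n).cont)
  · have := glue_cont hS' hS hC'.isClosed σ.symm h' hh.cont' hσ' (fun m => f' (σ.symm m))
      (fun m => by
        have := (hf (σ.symm m)).mapsTo'
        rwa [Equiv.apply_symm_apply] at this)
      (fun m => by
        have := (hf (σ.symm m)).cont'
        rwa [Equiv.apply_symm_apply] at this)
    exact this
  · intro y hy
    simp [hy]

lemma piece_homeo {Y : Type*} [TopologicalSpace Y] {G P : Set Y} (e : G ≃ₜ (ℕ → ℕ))
    (hP : ∃ W : Set Y, IsOpen W ∧ P = W ∩ G) (hne : P.Nonempty) :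
    Nonempty (P ≃ₜ (ℕ → ℕ)) := by
  obtain ⟨W, hW, rfl⟩ := hP
  have hf : IsEmbedding (fun z : ℕ → ℕ => ((e.symm z : G) : Y)) :=
    IsEmbedding.subtypeVal.comp e.symm.isEmbedding
  have hV : IsOpen ((fun z : ℕ → ℕ => ((e.symm z : G) : Y)) ⁻¹' W) := hW.preimage hf.continuous
  have him : (fun z : ℕ → ℕ => ((e.symm z : G) : Y)) ''
      ((fun z : ℕ → ℕ => ((e.symm z : G) : Y)) ⁻¹' W) = W ∩ G := by
    ext y
    constructor
    · rintro ⟨z, hz, rfl⟩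
      exact ⟨hz, (e.symm z).2⟩
    · rintro ⟨h1, h2⟩
      exact ⟨e ⟨y, h2⟩, by simpa using h1, by simp⟩
  have hVne : ((fun z : ℕ → ℕ => ((e.symm z : G) : Y)) ⁻¹' W).Nonempty := by
    rw [← him] at hne
    exact hne.of_image
  obtain ⟨e'⟩ := baire_open hV hVne
  exact ⟨(Homeomorph.setCongr him.symm).trans ((hf.homeomorphImage _).symm.trans e')⟩

lemma cover_compl.{u} {Y : Type u} [MetricSpace Y] [CompactSpace Y] {C : Set Y} (hC : IsCompact C)
    (hne : C.Nonempty) :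
    ∃ (ι : Type u) (_ : Countable ι) (O : ι → Set Y) (p : ι → Y), (∀ j, IsOpen (O j)) ∧
      (∀ y ∉ C, ∃ j, y ∈ O j) ∧ (∀ j, p j ∈ C) ∧
      (∀ j, ∃ δ > 0, ∀ y ∈ O j, ∀ c ∈ C, δ ≤ dist y c) ∧
      ∀ ε > 0, {j | ¬ ∀ y ∈ O j, dist y (p j) < ε}.Finite := by
  classical
  have hnet : ∀ k : ℕ, ∃ t : Finset Y, ∀ y, ∃ c ∈ t, dist y c < 1 / ((k : ℝ) + 1) := by
    intro k
    obtain ⟨t, -, htf, ht⟩ := finite_cover_balls_of_compact (isCompact_univ (X := Y))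
      (show (0 : ℝ) < 1 / ((k : ℝ) + 1) by positivity)
    refine ⟨htf.toFinset, fun y => ?_⟩
    have := ht (mem_univ y)
    simp only [mem_iUnion, Metric.mem_ball] at this
    obtain ⟨c, hc, h⟩ := this
    exact ⟨c, by simpa using hc, h⟩
  choose t ht using hnet
  set O : (Σ k : ℕ, t k) → Set Y := fun j => {y | 1 / ((j.1 : ℝ) + 2) < Metric.infDist y C ∧
    Metric.infDist y C * j.1 < 1 ∧ dist y j.2.1 < 1 / ((j.1 : ℝ) + 1)} with hO
  have hp : ∀ j, ∃ p ∈ C, j.1 ≠ 0 → ∀ y ∈ O j, dist y p < 3 / (j.1 : ℝ) := by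
    intro j
    by_cases hj : (O j).Nonempty
    · obtain ⟨y, h1, h2, h3⟩ := hj
      obtain ⟨p, hpC, hp⟩ := hC.exists_infDist_eq_dist hne y
      refine ⟨p, hpC, fun hj0 z hz => ?_⟩
      obtain ⟨z1, z2, z3⟩ := hz
      have hjp : (0 : ℝ) < j.1 := by exact_mod_cast Nat.pos_of_ne_zero hj0
      have h4 : dist y p < 1 / (j.1 : ℝ) := by
        rw [← hp, lt_div_iff₀ hjp]; exact h2
      have h5 : 1 / ((j.1 : ℝ) + 1) ≤ 1 / (j.1 : ℝ) := by
        apply one_div_le_one_div_of_le hjp; linarith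
      have h6 := dist_triangle z y p
      have h7 := dist_triangle_right z y j.2.1
      have h8 : 3 / (j.1 : ℝ) = 1 / j.1 + 1 / j.1 + 1 / j.1 := by ring
      linarith
    · obtain ⟨p, hp⟩ := hne
      exact ⟨p, hp, fun _ y hy => absurd ⟨y, hy⟩ hj⟩
  choose p hpC hp using hp
  have hcont : Continuous (fun y => Metric.infDist y C) := Metric.continuous_infDist_pt C
  refine ⟨Σ k : ℕ, t k, inferInstance, O, p, ?_, ?_, hpC, ?_, ?_⟩
  · intro j
    refine (isOpen_lt continuous_const hcont).inter ((isOpen_lt (hcont.mul continuous_const)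
      continuous_const).inter (isOpen_lt (continuous_id.dist continuous_const) continuous_const))
  · intro y hy
    have hr : 0 < Metric.infDist y C := (hC.isClosed.notMem_iff_infDist_pos hne).1 hy
    set r := Metric.infDist y C with hrdef
    obtain ⟨k, hk⟩ : ∃ k : ℕ, ⌈1 / r⌉₊ = k + 1 :=
      Nat.exists_eq_succ_of_ne_zero (Nat.ceil_pos.2 (by positivity)).ne'
    have h1 : 1 / r ≤ k + 1 := by
      have := Nat.le_ceil (1 / r)
      rw [hk] at this
      exact_mod_cast this
    have h2 : (k : ℝ) < 1 / r := by
      apply Nat.lt_ceil.1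
      omega
    obtain ⟨c, hc, hcd⟩ := ht k y
    refine ⟨⟨k, c, hc⟩, ?_, ?_, hcd⟩
    · show 1 / ((k : ℝ) + 2) < r
      rw [div_lt_iff₀ (by positivity)]
      rw [div_le_iff₀ hr] at h1
      nlinarith
    · show r * k < 1
      rw [lt_div_iff₀ hr] at h2
      linarith
  · intro j
    refine ⟨1 / ((j.1 : ℝ) + 2), by positivity, fun y hy c hc => ?_⟩
    exact hy.1.le.trans (Metric.infDist_le_dist_of_mem hc)
  · intro ε hε
    obtain ⟨N, hN⟩ := exists_nat_gt (3 / ε)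
    have hfin : (⋃ k ∈ Finset.range (N + 1), range (Sigma.mk (β := fun k => t k) k)).Finite :=
      (Finset.range (N + 1)).finite_toSet.biUnion (fun k _ => finite_range _)
    refine hfin.subset ?_
    rintro ⟨k, c⟩ hj
    simp only [mem_iUnion]
    refine ⟨k, ?_, ⟨c, rfl⟩⟩
    by_contra hk
    simp only [Finset.mem_range, not_lt] at hk
    apply hj
    intro y hy
    have hk0 : k ≠ 0 := by omega
    refine (hp ⟨k, c⟩ hk0 y hy).trans_le ?_
    have hkN : (N : ℝ) ≤ k := by exact_mod_cast (by omega : N ≤ k)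
    have hkp : (0 : ℝ) < k := by exact_mod_cast Nat.pos_of_ne_zero hk0
    show 3 / (k : ℝ) ≤ ε
    rw [div_le_iff₀ hkp]
    rw [div_lt_iff₀ hε] at hN
    nlinarith

lemma exists_shrink {Y : Type*} [MetricSpace Y] [CompactSpace Y] {G U C : Set Y}
    (hG : Nonempty (G ≃ₜ (ℕ → ℕ))) (hU : ∃ W : Set Y, IsOpen W ∧ U = W ∩ G) (hUne : U.Nonempty)
    (hC : IsCompact C) (hne : C.Nonempty) (hcl : C ⊆ closure U) (hd : Disjoint U C) :
    ∃ i x, ShrinkPart U C i x ∧ ∀ n, Nonempty ({y ∈ U | i y = n} ≃ₜ (ℕ → ℕ)) := by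
  classical
  obtain ⟨eG⟩ := hG
  obtain ⟨e⟩ := piece_homeo eG hU hUne
  obtain ⟨ι, hι, O, p, hO, hcov, hpC, hfar, hfin⟩ := cover_compl hC hne
  obtain ⟨i0, hi0, hi0O⟩ := baire_select (fun j => (fun z => ((e.symm z : U) : Y)) ⁻¹' O j)
    (fun j => (hO j).preimage (continuous_subtype_val.comp e.symm.continuous))
    (fun z => hcov _ (fun hc => hd.le_bot ⟨(e.symm z).2, hc⟩))
  have hinf : (range i0).Infinite := by
    intro hf
    choose δ hδ hδ' using hfar
    obtain ⟨c, hc⟩ := hne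
    have : ∃ η > 0, ∀ j ∈ range i0, η ≤ δ j := by
      have hne' : (range i0).Nonempty := range_nonempty _
      obtain ⟨j, hj, hmin⟩ := exists_min_image (range i0) δ hf hne'
      exact ⟨δ j, hδ j, hmin⟩
    obtain ⟨η, hη, hη'⟩ := this
    obtain ⟨y, hy, hyc⟩ := Metric.mem_closure_iff.1 (hcl hc) η hη
    have h1 := hi0O (e ⟨y, hy⟩)
    simp only [mem_preimage, Homeomorph.symm_apply_apply] at h1
    have h2 := hδ' _ y h1 c hc
    have h3 := hη' _ (mem_range_self (e ⟨y, hy⟩))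
    rw [dist_comm] at hyc
    linarith
  have : Infinite (range i0) := hinf.to_subtype
  obtain ⟨den⟩ := nonempty_denumerable (range i0)
  let ρ : range i0 ≃ ℕ := Denumerable.eqv _
  set i : Y → ℕ := fun y => if h : y ∈ U then ρ ⟨i0 (e ⟨y, h⟩), mem_range_self _⟩ else 0 with hi
  have hiU : ∀ y : U, i y = ρ ⟨i0 (e y), mem_range_self _⟩ := by
    intro y; simp [hi]
  have hiO : ∀ y ∈ U, y ∈ O (ρ.symm (i y)).1 := by
    intro y hy
    have h1 := hi0O (e ⟨y, hy⟩)
    simp only [mem_preimage, Homeomorph.symm_apply_apply] at h1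
    rw [hiU ⟨y, hy⟩]
    simpa using h1
  have hloc : ∀ y ∈ U, ∀ᶠ z in 𝓝[U] y, i z = i y := by
    intro y hy
    rw [nhdsWithin_eq_map_subtype_coe hy, eventually_map]
    have := (hi0.comp_continuous e.continuous).eventually_eq ⟨y, hy⟩
    filter_upwards [this] with z hz
    rw [hiU z, hiU ⟨y, hy⟩]
    congr 1
    exact Subtype.ext hz
  have hnes : ∀ n, ∃ y ∈ U, i y = n := by
    intro n
    obtain ⟨z, hz⟩ := (ρ.symm n).2
    refine ⟨e.symm z, (e.symm z).2, ?_⟩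
    rw [hiU]
    simp [hz]
  refine ⟨i, fun n => p (ρ.symm n).1, ⟨hnes, hloc, ?_, fun n => hpC _, ?_⟩, ?_⟩
  · intro n
    obtain ⟨δ, hδ, h⟩ := hfar (ρ.symm n).1
    refine ⟨δ, hδ, fun y hy hyn => h y ?_⟩
    rw [← hyn]; exact hiO y hy
  · intro ε hε
    have h1 : Tendsto (fun n => (ρ.symm n).1) atTop cofinite := by
      rw [← Nat.cofinite_eq_atTop]
      exact (Subtype.val_injective.comp ρ.symm.injective).tendsto_cofinite
    have h2 := h1.eventually (hfin ε hε).compl_mem_cofinite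
    filter_upwards [h2] with n hn y hy hyn
    have h3 : ∀ y ∈ O (ρ.symm n).1, dist y (p (ρ.symm n).1) < ε := by
      by_contra hcon
      exact hn hcon
    apply h3
    rw [← hyn]; exact hiO y hy
  · intro n
    refine piece_homeo eG ?_ (hnes n)
    obtain ⟨W, hW, hUW⟩ := hU
    have : ∀ y : U, ∃ T : Set Y, IsOpen T ∧ y.1 ∈ T ∧ ∀ z ∈ T, z ∈ U → i z = i y := by
      intro y
      have h1 := eventually_nhdsWithin_iff.1 (hloc y y.2)
      obtain ⟨T, hT, hTo, hyT⟩ := eventually_nhds_iff.1 h1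
      exact ⟨T, hTo, hyT, hT⟩
    choose T hTo hyT hT using this
    refine ⟨W ∩ ⋃ y : {y : U // i y = n}, T y.1,
      hW.inter (isOpen_iUnion fun y => hTo _), ?_⟩
    ext z
    simp only [mem_ofPred_eq, mem_inter_iff, mem_iUnion]
    constructor
    · rintro ⟨hz, hzn⟩
      have hz' := hz
      rw [hUW] at hz'
      exact ⟨⟨hz'.1, ⟨⟨⟨z, hz⟩, hzn⟩, hyT _⟩⟩, hz'.2⟩
    · rintro ⟨⟨hzW, y, hy⟩, hzG⟩
      have hzU : z ∈ U := by rw [hUW]; exact ⟨hzW, hzG⟩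
      exact ⟨hzU, (hT _ z hy hzU).trans y.2⟩

lemma lusin_compact {X : Type*} [MetricSpace X] [CompactSpace X] [MeasurableSpace X]
    [BorelSpace X] (μ : Measure X) {B : Set X} (hB : MeasurableSet B) (hpos : 0 < μ B)
    (hfin : μ B < ⊤) {φ : X → ℝ} (hφ : Measurable φ) :
    ∃ K ⊆ B, IsCompact K ∧ 0 < μ K ∧ ContinuousOn φ K := by
  have : IsFiniteMeasure (μ.restrict B) := isFiniteMeasure_restrict.2 hfin.ne
  let ι := TopologicalSpace.countableBasis ℝ
  have hι : Countable ι := (TopologicalSpace.countable_countableBasis ℝ).to_subtype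
  have hιo : ∀ v : ι, IsOpen v.1 := fun v => TopologicalSpace.isOpen_of_mem_countableBasis v.2
  obtain ⟨ε, hε, hsum⟩ := ENNReal.exists_pos_sum_of_countable' hpos.ne' (ι × Bool)
  have hC : ∀ v : ι, ∃ C ⊆ φ ⁻¹' v.1 ∩ B, IsCompact C ∧
      (μ.restrict B) ((φ ⁻¹' v.1 ∩ B) \ C) < ε (v, true) := fun v =>
    (((hιo v).measurableSet.preimage hφ).inter hB).exists_isCompact_sdiff_lt
      (measure_ne_top _ _) (hε _).ne'
  have hC' : ∀ v : ι, ∃ C ⊆ B \ φ ⁻¹' v.1, IsCompact C ∧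
      (μ.restrict B) ((B \ φ ⁻¹' v.1) \ C) < ε (v, false) := fun v =>
    (hB.diff ((hιo v).measurableSet.preimage hφ)).exists_isCompact_sdiff_lt
      (measure_ne_top _ _) (hε _).ne'
  choose C hCs hCc hCm using hC
  choose C' hCs' hCc' hCm' using hC'
  have hιne : Nonempty ι := by
    obtain ⟨v, hv, -⟩ := (TopologicalSpace.isBasis_countableBasis ℝ).exists_subset_of_mem_open
      (mem_univ (0 : ℝ)) isOpen_univ
    exact ⟨⟨v, hv⟩⟩
  have hKcl : IsClosed (⋂ v, (C v ∪ C' v)) :=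
    isClosed_iInter fun v => ((hCc v).union (hCc' v)).isClosed
  have hKB : (⋂ v, (C v ∪ C' v)) ⊆ B := by
    intro x hx
    rcases mem_iInter.1 hx hιne.some with h | h
    · exact (hCs _ h).2
    · exact (hCs' _ h).1
  refine ⟨⋂ v, (C v ∪ C' v), hKB, hKcl.isCompact, ?_, ?_⟩
  · have h1 : μ.restrict B (B \ ⋂ v, (C v ∪ C' v)) < μ B := by
      refine lt_of_le_of_lt ?_ hsum
      have hsub : B \ (⋂ v, (C v ∪ C' v)) ⊆ ⋃ p : ι × Bool,
          (if p.2 then (φ ⁻¹' p.1.1 ∩ B) \ C p.1 else (B \ φ ⁻¹' p.1.1) \ C' p.1) := by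
        rintro x ⟨hxB, hx⟩
        simp only [mem_iInter, not_forall, mem_union, not_or] at hx
        obtain ⟨v, hv1, hv2⟩ := hx
        rw [mem_iUnion]
        by_cases h : x ∈ φ ⁻¹' v.1
        · exact ⟨(v, true), by simp only [if_true]; exact ⟨⟨h, hxB⟩, hv1⟩⟩
        · exact ⟨(v, false), by simpa using ⟨⟨hxB, h⟩, hv2⟩⟩
      refine (measure_mono hsub).trans ((measure_iUnion_le _).trans (ENNReal.tsum_le_tsum ?_))
      rintro ⟨v, b⟩
      cases b
      · simpa using (hCm' v).le
      · simpa using (hCm v).le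
    by_contra hK
    have hK0 : μ (⋂ v, (C v ∪ C' v)) = 0 := by simpa using hK
    have h2 : μ B ≤ μ.restrict B (B \ ⋂ v, (C v ∪ C' v)) := by
      rw [Measure.restrict_eq_self _ sdiff_subset, measure_sdiff_null hK0]
    exact absurd h1 (not_lt.2 h2)
  · intro x hx
    rw [ContinuousWithinAt, (TopologicalSpace.isBasis_countableBasis ℝ).nhds_hasBasis.tendsto_right_iff]
    rintro v ⟨hv, hxv⟩
    have hxC : x ∉ C' ⟨v, hv⟩ := fun h => (hCs' _ h).2 hxv
    filter_upwards [self_mem_nhdsWithin,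
      mem_nhdsWithin_of_mem_nhds ((hCc' ⟨v, hv⟩).isClosed.isOpen_compl.mem_nhds hxC)] with z h1 h2
    rcases mem_iInter.1 h1 ⟨v, hv⟩ with h | h
    · exact (hCs _ h).1
    · exact absurd h h2

lemma cdf_lebesgue (m : Measure ℝ) [IsFiniteMeasure m] [NullSingletonClass m] :
    ∃ F : ℝ → ℝ, Monotone F ∧ Continuous F ∧
      m.map F = (volume : Measure ℝ).restrict (Icc 0 (m.real univ)) := by
  set F : ℝ → ℝ := fun t => m.real (Iic t) with hF
  have hmono : Monotone F := fun s t hst => measureReal_mono (Iic_subset_Iic.2 hst)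
  have hcont : Continuous F := by
    have h1 : Continuous fun b : ℝ => ∫ _ in (0 : ℝ)..b, (1 : ℝ) ∂m :=
      intervalIntegral.continuous_primitive (fun a b => by simp) 0
    have h2 : F = fun t => F 0 + ∫ _ in (0 : ℝ)..t, (1 : ℝ) ∂m := by
      funext t
      rw [← intervalIntegral.integral_Iic_sub_Iic (by simp) (by simp)]
      simp [hF]
    rw [h2]
    exact continuous_const.add h1
  have hbot : Tendsto F atBot (𝓝 0) := by
    have h1 := (ENNReal.tendsto_toReal (measure_ne_top m univ)).comp (tendsto_measure_Ici_atBot m)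
    have h2 : F = fun t => m.real univ - m.real (Ici t) := by
      funext t
      rw [← measureReal_compl measurableSet_Ici, compl_Ici]
      simp only [hF, Measure.real, measure_congr (Iio_ae_eq_Iic (μ := m) (a := t))]
    rw [h2]
    have h3 := h1.const_sub (m.real univ)
    simpa [Measure.real, Function.comp_def] using h3
  have htop : Tendsto F atTop (𝓝 (m.real univ)) := by
    have := (ENNReal.tendsto_toReal (measure_ne_top m univ)).comp (tendsto_measure_Iic_atTop m)
    simpa [hF, Measure.real, Function.comp_def] using this
  have hsurj : ∀ s, 0 < s → s < m.real univ → ∃ t, F t = s := by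
    intro s h0 h1
    obtain ⟨a, ha⟩ := (hbot.eventually (gt_mem_nhds h0)).exists
    obtain ⟨b, hb⟩ := (htop.eventually (lt_mem_nhds h1)).exists
    exact mem_range_of_exists_le_of_exists_ge hcont ⟨a, ha.le⟩ ⟨b, hb.le⟩
  have hF0 : ∀ t, 0 ≤ F t := fun t => measureReal_nonneg
  have hFM : ∀ t, F t ≤ m.real univ := fun t => measureReal_mono (subset_univ _)
  refine ⟨F, hmono, hcont, ?_⟩
  refine Measure.ext_of_Iic _ _ fun s => ?_
  rw [Measure.map_apply hcont.measurable measurableSet_Iic,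
    Measure.restrict_apply measurableSet_Iic]
  rcases lt_or_ge s 0 with hs | hs
  · have h1 : F ⁻¹' Iic s = ∅ := by
      ext t; simpa using hs.trans_le (hF0 t)
    have h2 : Iic s ∩ Icc 0 (m.real univ) = ∅ := by
      ext t; simp only [mem_inter_iff, mem_Iic, mem_Icc, mem_empty_iff_false, iff_false]
      intro h; linarith [h.1, h.2.1]
    rw [h1, h2]; simp
  rcases lt_or_ge s (m.real univ) with hs1 | hs1
  · have h2 : Iic s ∩ Icc 0 (m.real univ) = Icc 0 s := by
      ext t; simp only [mem_inter_iff, mem_Iic, mem_Icc]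
      constructor
      · intro h; exact ⟨h.2.1, h.1⟩
      · intro h; exact ⟨h.2, h.1, h.2.trans hs1.le⟩
    rw [h2, Real.volume_Icc, sub_zero, ← ENNReal.ofReal_toReal (measure_ne_top m (F ⁻¹' Iic s))]
    congr 1
    change m.real (F ⁻¹' Iic s) = s
    apply le_antisymm
    · by_contra hcon
      push Not at hcon
      obtain ⟨s', h3, h4⟩ := exists_between (lt_min hcon hs1)
      obtain ⟨t, ht⟩ := hsurj s' (hs.trans_lt h3) (h4.trans_le (min_le_right _ _))
      have h5 : m.real (F ⁻¹' Iic s) ≤ F t := by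
        refine measureReal_mono ?_
        intro u hu
        by_contra hut
        simp only [mem_Iic, not_le] at hut
        have := hmono hut.le
        have hu' : F u ≤ s := hu
        linarith
      have := h4.trans_le (min_le_left _ _)
      linarith
    · rcases hs.eq_or_lt with rfl | hs'
      · exact measureReal_nonneg
      · obtain ⟨t, ht⟩ := hsurj s hs' hs1
        rw [← ht]
        refine measureReal_mono ?_
        intro u hu
        exact hmono hu
  · have h1 : F ⁻¹' Iic s = univ := by
      ext t; simpa using (hFM t).trans hs1
    have h2 : Iic s ∩ Icc 0 (m.real univ) = Icc 0 (m.real univ) := by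
      apply inter_eq_right.2
      intro t ht; exact ht.2.trans hs1
    rw [h1, h2, Real.volume_Icc, sub_zero]
    simp [Measure.real]

lemma monotone_countable_dup {F : ℝ → ℝ} (hF : Monotone F) :
    ∃ D : Set ℝ, D.Countable ∧ ∀ s t, F s = F t → F s ∉ D → s = t := by
  refine ⟨range (fun q : ℚ => F q), countable_range _, ?_⟩
  have key : ∀ s t, s < t → F s = F t → F s ∈ range (fun q : ℚ => F q) := by
    intro s t hst he
    obtain ⟨q, h1, h2⟩ := exists_rat_btwn hst
    exact ⟨q, le_antisymm (he ▸ hF h2.le) (hF h1.le)⟩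
  intro s t he hn
  rcases lt_trichotomy s t with h | h | h
  · exact absurd (key s t h he) hn
  · exact h
  · exact absurd (he ▸ key t s h he.symm) hn

lemma affine_avoid {L : Set unitInterval} (hL : IsClosed L) (hint : interior L = ∅)
    {D : Set ℝ} (hD : D.Countable) {M : ℝ} (hM : 0 < M) :
    ∃ a b : ℝ, 0 < a ∧ ∀ l ∈ L, a * (l : ℝ) + b ∈ Ioo 0 M ∧ a * (l : ℝ) + b ∉ D := by
  have ha : 0 < M / 3 := by positivity
  have hL1 : IsClosed ((↑) '' L : Set ℝ) :=
    (isClosed_Icc.isClosedEmbedding_subtypeVal).isClosedMap L hL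
  have hLi : interior ((↑) '' L : Set ℝ) = ∅ := by
    by_contra hne
    obtain ⟨t, ht⟩ := nonempty_iff_ne_empty.2 hne
    obtain ⟨l, hl, rfl⟩ := interior_subset ht
    have h1 : (Subtype.val ⁻¹' (interior ((↑) '' L : Set ℝ)) : Set unitInterval) ⊆ interior L := by
      apply interior_maximal
      · intro z hz
        obtain ⟨w, hw, hwz⟩ := interior_subset (show (z : ℝ) ∈ _ from hz)
        rwa [← Subtype.ext hwz]
      · exact isOpen_interior.preimage continuous_subtype_val
    have h2 := h1 ht
    rw [hint] at h2
    exact h2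
  have hdense : Dense (⋂ d ∈ D, {b : ℝ | (d - b) / (M / 3) ∈ ((↑) '' L : Set ℝ)ᶜ}) := by
    refine dense_biInter_of_isOpen (fun d _ => ?_) hD (fun d _ => ?_)
    · exact hL1.isOpen_compl.preimage (by fun_prop)
    · have hdc : Dense ((↑) '' L : Set ℝ)ᶜ := interior_eq_empty_iff_dense_compl.1 hLi
      have : {b : ℝ | (d - b) / (M / 3) ∈ ((↑) '' L : Set ℝ)ᶜ} =
          (fun t => d - (M / 3) * t) '' ((↑) '' L : Set ℝ)ᶜ := by
        ext b
        simp only [mem_ofPred_eq, mem_image]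
        constructor
        · intro h; exact ⟨_, h, by field_simp; ring⟩
        · rintro ⟨t, ht, rfl⟩
          have : (d - (d - M / 3 * t)) / (M / 3) = t := by field_simp; ring
          rwa [this]
      rw [this]
      refine DenseRange.dense_image (Function.Surjective.denseRange fun b =>
        ⟨(d - b) / (M / 3), by field_simp; ring⟩) (by fun_prop) hdc
  obtain ⟨b, hb, hbD⟩ := hdense.exists_mem_open isOpen_Ioo (nonempty_Ioo.2 ha)
  refine ⟨M / 3, b, ha, fun l hl => ⟨⟨?_, ?_⟩, ?_⟩⟩
  · have := mul_nonneg ha.le l.2.1; linarith [hbD.1]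
  · have := mul_le_mul_of_nonneg_left l.2.2 ha.le; linarith [hbD.2]
  · intro hd
    have := mem_iInter₂.1 hb _ hd
    apply this
    refine ⟨l, hl, ?_⟩
    field_simp; ring

open scoped Pointwise in
lemma volume_affine {a b : ℝ} (ha : 0 < a) (A : Set unitInterval) :
    (volume : Measure ℝ) ((fun l : unitInterval => a * (l : ℝ) + b) '' A) =
      ENNReal.ofReal a * (volume : Measure unitInterval) A := by
  have h1 : (fun l : unitInterval => a * (l : ℝ) + b) '' A =
      (fun t => t + b) '' (a • (Subtype.val '' A : Set ℝ)) := by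
    rw [← image_smul, image_image, image_image]
    rfl
  rw [h1, image_add_right, measure_preimage_add_right, Measure.addHaar_smul]
  rw [volume_image_subtype_coe measurableSet_Icc]
  simp [abs_of_pos ha]

lemma exists_embed {X : Type*} [MetricSpace X] [CompactSpace X] [MeasurableSpace X]
    [BorelSpace X] (μ : Measure X) (hμna : ∀ x : X, μ {x} = 0)
    {B : Set X} (hB : MeasurableSet B) (hpos : 0 < μ B)
    (hfin : μ B < ⊤) {L : Set unitInterval} (hL : IsCompact L) (hint : interior L = ∅) :
    ∃ L' ⊆ B, IsCompact L' ∧ ∃ e : L ≃ₜ L', ∃ c : ℝ≥0∞, 0 < c ∧ c ≠ ⊤ ∧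
      ∀ A ⊆ L, MeasurableSet A →
        μ (Subtype.val '' (e '' (Subtype.val ⁻¹' A))) = c * (volume : Measure unitInterval) A := by
  have hφ := measurableEmbedding_embeddingReal X
  set φ := embeddingReal X with hφdef
  obtain ⟨K, hKB, hK, hKpos, hKc⟩ := lusin_compact μ hB hpos hfin hφ.measurable
  have hKfin : μ K < ⊤ := (measure_mono hKB).trans_lt hfin
  have hfinm : IsFiniteMeasure (μ.restrict K) := isFiniteMeasure_restrict.2 hKfin.ne
  set m : Measure ℝ := (μ.restrict K).map φ with hm
  have hna : NullSingletonClass m := by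
    refine ⟨fun t => ?_⟩
    rw [hm, Measure.map_apply hφ.measurable (measurableSet_singleton t)]
    have hs : (φ ⁻¹' {t}).Subsingleton := subsingleton_singleton.preimage hφ.injective
    rcases hs.eq_empty_or_singleton with h | ⟨x, h⟩
    · rw [h]; simp
    · rw [h]
      exact le_antisymm ((Measure.restrict_apply_le _ _).trans (hμna x).le) zero_le
  have hmuniv : m univ = μ K := by
    rw [hm, Measure.map_apply hφ.measurable MeasurableSet.univ]
    simp
  have hM : 0 < m.real univ := by
    rw [Measure.real, hmuniv]
    exact ENNReal.toReal_pos hKpos.ne' hKfin.ne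
  obtain ⟨F, hFm, hFc, hFmap⟩ := cdf_lebesgue m
  obtain ⟨D, hD, hDF⟩ := monotone_countable_dup hFm
  obtain ⟨a, b, ha, hab⟩ := affine_avoid hL.isClosed hint hD hM
  set T : unitInterval → ℝ := fun l => a * (l : ℝ) + b with hT
  have hTcont : Continuous T := by fun_prop
  have hTinj : Function.Injective T := by
    intro l l' h
    apply Subtype.ext
    have : a * (l : ℝ) + b = a * l' + b := h
    exact mul_left_cancel₀ ha.ne' (add_right_cancel this)
  have hTemb : IsClosedEmbedding T := hTcont.isClosedEmbedding hTinj
  have hΨm : Measurable (F ∘ φ) := hFc.measurable.comp hφ.measurable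
  have hΨc : ContinuousOn (F ∘ φ) K := hFc.comp_continuousOn hKc
  have hmeas : ∀ S : Set ℝ, MeasurableSet S → S ⊆ Icc 0 (m.real univ) →
      μ (K ∩ (F ∘ φ) ⁻¹' S) = volume S := by
    intro S hS hSs
    have h1 : m.map F S = volume S := by
      rw [hFmap, Measure.restrict_apply hS, inter_eq_left.2 hSs]
    rw [← h1, hm, Measure.map_map hFc.measurable hφ.measurable, Measure.map_apply hΨm hS,
      Measure.restrict_apply (hΨm hS), inter_comm]
  have hsurj : ∀ s ∈ Ioo 0 (m.real univ), ∃ x ∈ K, F (φ x) = s := by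
    have hcl : IsClosed ((F ∘ φ) '' K) := (hK.image_of_continuousOn hΨc).isClosed
    have hop : IsOpen (Ioo 0 (m.real univ) \ (F ∘ φ) '' K) := isOpen_Ioo.sdiff hcl
    have h0 := hmeas _ hop.measurableSet (sdiff_subset.trans Ioo_subset_Icc_self)
    have h1 : K ∩ (F ∘ φ) ⁻¹' (Ioo 0 (m.real univ) \ (F ∘ φ) '' K) = ∅ := by
      ext x
      simp only [mem_inter_iff, mem_empty_iff_false, iff_false]
      rintro ⟨hx, -, hn⟩
      exact hn ⟨x, hx, rfl⟩
    rw [h1, measure_empty] at h0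
    have h2 := (hop.measure_eq_zero_iff volume).1 h0.symm
    intro s hs
    by_contra hcon
    have : s ∈ Ioo 0 (m.real univ) \ (F ∘ φ) '' K := ⟨hs, fun ⟨x, hx, hxs⟩ => hcon ⟨x, hx, hxs⟩⟩
    rw [h2] at this
    exact this
  set L' : Set X := K ∩ (F ∘ φ) ⁻¹' (T '' L) with hL'
  have hTL : IsCompact (T '' L) := hL.image hTcont
  have hL'c : IsCompact L' :=
    (hΨc.preimage_isClosed_of_isClosed hK.isClosed hTL.isClosed).isCompact
  have hinj : ∀ x ∈ L', ∀ y ∈ L', F (φ x) = F (φ y) → x = y := by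
    rintro x ⟨hx, l, hl, hlx⟩ y hy he
    apply hφ.injective
    apply hDF _ _ he
    have := (hab l hl).2
    change T l ∉ D at this
    rw [hlx] at this
    exact this
  have hcomp : CompactSpace L' := isCompact_iff_compactSpace.1 hL'c
  let Ψ : L' ≃ (T '' L : Set ℝ) := Equiv.ofBijective (fun x => ⟨F (φ x), x.2.2⟩) (by
    constructor
    · intro x y h
      exact Subtype.ext (hinj x x.2 y y.2 (congrArg Subtype.val h))
    · rintro ⟨s, l, hl, rfl⟩
      obtain ⟨x, hx, hxs⟩ := hsurj (T l) (hab l hl).1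
      exact ⟨⟨x, hx, l, hl, hxs.symm⟩, Subtype.ext hxs⟩)
  have hΨcont : Continuous Ψ := by
    refine Continuous.subtype_mk ?_ _
    exact continuousOn_iff_continuous_domRestrict.1 (hΨc.mono inter_subset_left)
  let e : L ≃ₜ L' := (hTemb.isEmbedding.homeomorphImage L).trans
    (Continuous.homeoOfEquivCompactToT2 hΨcont).symm
  have he : ∀ l : L, F (φ (e l)) = T l := by
    intro l
    have h1 : Ψ (e l) = hTemb.isEmbedding.homeomorphImage L l :=
      Ψ.apply_symm_apply _
    exact congrArg Subtype.val h1
  refine ⟨L', inter_subset_left.trans hKB, hL'c, e, ENNReal.ofReal a, by simpa using ha,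
    ENNReal.ofReal_ne_top, ?_⟩
  intro A hA hAm
  have him : Subtype.val '' (e '' (Subtype.val ⁻¹' A)) = K ∩ (F ∘ φ) ⁻¹' (T '' A) := by
    ext x
    constructor
    · rintro ⟨_, ⟨l, hl, rfl⟩, rfl⟩
      exact ⟨(e l).2.1, l, hl, (he l).symm⟩
    · rintro ⟨hx, l, hl, hlx⟩
      refine ⟨e ⟨l, hA hl⟩, ⟨⟨l, hA hl⟩, hl, rfl⟩, ?_⟩
      apply hinj _ (e _).2 _ ⟨hx, l, hA hl, hlx⟩
      rw [he]
      exact hlx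
  rw [him, hmeas _ (hTemb.measurableEmbedding.measurableSet_image.2 hAm), volume_affine ha]
  rintro _ ⟨l, hl, rfl⟩
  exact Ioo_subset_Icc_self (hab l (hA hl)).1


/-- Claim 6.6 (based on theorems of Oxtoby, Gelbaum and Pollard), for the σ-ideal
`J₀`. -/
theorem statement13 {X : Type*}
    [MetricSpace X] [CompactSpace X] [Nonempty X] [MeasurableSpace X] [BorelSpace X]
    (μ : Measure X) (hμna : ∀ x : X, μ {x} = 0) (hμsemi : Semifinite μ)
    (G : Set unitInterval) (hGirr : Nonempty (G ≃ₜ (ℕ → ℕ)))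
    (hGdense : Dense G) (hG0 : (volume : Measure unitInterval) G = 0)
    (U : Set unitInterval) (hUne : U.Nonempty)
    (hUopen : ∃ W : Set unitInterval, IsOpen W ∧ U = W ∩ G)
    (G' : Set X) (hG'irr : Nonempty (G' ≃ₜ (ℕ → ℕ))) (hG'0 : μ G' = 0)
    (U' : Set X) (hU'ne : U'.Nonempty) (hU'open : ∃ W : Set X, IsOpen W ∧ U' = W ∩ G')
    (hU'pos : 0 < μ (closure U' \ G'))
    (L : Set unitInterval) (hLsub : L ⊆ closure U \ U)
    (hLCantor : Nonempty (L ≃ₜ (ℕ → Bool)))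
    (hLpos : 0 < (volume : Measure unitInterval) L) :
    ∃ L' : Set X, L' ⊆ closure U' \ U' ∧ Nonempty (L' ≃ₜ (ℕ → Bool)) ∧ 0 < μ L' ∧
      ∃ g : (U ∪ L : Set unitInterval) ≃ₜ ((U' ∪ L' : Set X)),
        Subtype.val '' (g '' (Subtype.val ⁻¹' L)) = L' ∧
        (∃ c : ℝ≥0∞, 0 < c ∧ c ≠ ⊤ ∧
          ∀ A : Set unitInterval, A ⊆ L → MeasurableSet A →
            μ (Subtype.val '' (g '' (Subtype.val ⁻¹' A))) =
              c * (volume : Measure unitInterval) A) ∧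
        ∀ A : Set unitInterval, A ⊆ L →
          ((volume : Measure unitInterval) A = 0 ↔
            μ (Subtype.val '' (g '' (Subtype.val ⁻¹' A))) = 0) := by
  have hLc : IsCompact L := by
    obtain ⟨eL⟩ := hLCantor
    exact isCompact_iff_compactSpace.2 eL.symm.compactSpace
  have hLne : L.Nonempty := nonempty_of_measure_ne_zero hLpos.ne'
  have hint : interior L = ∅ := by
    by_contra hne
    obtain ⟨l, hl⟩ := nonempty_iff_ne_empty.2 hne
    obtain ⟨u, hu, huU⟩ := mem_closure_iff.1 (hLsub (interior_subset hl)).1 _ isOpen_interior hl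
    exact (hLsub (interior_subset hu)).2 huU
  have hG't : μ (toMeasurable μ G') = 0 := by rw [measure_toMeasurable, hG'0]
  obtain ⟨B, hBsub, hBm, hBpos, hBfin⟩ := hμsemi (closure U' \ toMeasurable μ G')
    (isClosed_closure.measurableSet.diff (measurableSet_toMeasurable _ _)) (by
      rw [measure_sdiff_null hG't]
      exact hU'pos.trans_le (measure_mono sdiff_subset))
  obtain ⟨L', hL'B, hL'c, e, c, hc0, hct, hmeas⟩ := exists_embed μ hμna hBm hBpos hBfin hLc hint
  have hU'G' : U' ⊆ G' := by
    obtain ⟨W, -, rfl⟩ := hU'open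
    exact inter_subset_right
  have hL'sub : L' ⊆ closure U' \ U' := fun x hx =>
    ⟨(hBsub (hL'B hx)).1, fun hxU =>
      (hBsub (hL'B hx)).2 (subset_toMeasurable μ G' (hU'G' hxU))⟩
  have hL'ne : L'.Nonempty := ⟨_, (e ⟨hLne.some, hLne.some_mem⟩).2⟩
  have hd : Disjoint U L := disjoint_left.2 fun x h1 h2 => (hLsub h2).2 h1
  have hd' : Disjoint U' L' := disjoint_left.2 fun x h1 h2 => (hL'sub h2).2 h1
  obtain ⟨i, x, hS, hp⟩ := exists_shrink hGirr hUopen hUne hLc hLne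
    (fun x hx => (hLsub hx).1) hd
  obtain ⟨i', x', hS', hp'⟩ := exists_shrink hG'irr hU'open hU'ne hL'c hL'ne
    (fun x hx => (hL'sub hx).1) hd'
  obtain ⟨h, h', hh, hhe⟩ := SetHomeo.of_homeo e hLne
  obtain ⟨g₀, g₀', hg₀, hg₀h⟩ := glue hS hS' hLc hL'c hd hd' (fun x hx => (hLsub hx).1)
    (fun x hx => (hL'sub hx).1) hp hp' hh
  obtain ⟨g, hg⟩ := hg₀.toHomeo
  have himg : ∀ A ⊆ L, Subtype.val '' (g '' (Subtype.val ⁻¹' A)) =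
      Subtype.val '' (e '' (Subtype.val ⁻¹' A)) := by
    intro A hA
    ext y
    constructor
    · rintro ⟨_, ⟨l, hl, rfl⟩, rfl⟩
      refine ⟨e ⟨l, hA hl⟩, ⟨⟨l, hA hl⟩, hl, rfl⟩, ?_⟩
      rw [hg, hg₀h _ (hA hl), ← hhe]
    · rintro ⟨_, ⟨l, hl, rfl⟩, rfl⟩
      refine ⟨g ⟨l, Or.inr l.2⟩, ⟨⟨l, Or.inr l.2⟩, hl, rfl⟩, ?_⟩
      rw [hg, hg₀h _ l.2, ← hhe]
  have hmeas' : ∀ A : Set unitInterval, A ⊆ L → MeasurableSet A →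
      μ (Subtype.val '' (g '' (Subtype.val ⁻¹' A))) =
        c * (volume : Measure unitInterval) A := by
    intro A hA hAm
    rw [himg A hA, hmeas A hA hAm]
  have hgL : Subtype.val '' (g '' (Subtype.val ⁻¹' L)) = L' := by
    rw [himg L le_rfl]
    simp
  refine ⟨L', hL'sub, ?_, ?_, g, hgL, ⟨c, hc0, hct, hmeas'⟩, ?_⟩
  · obtain ⟨eL⟩ := hLCantor
    exact ⟨e.symm.trans eL⟩
  · rw [← hgL, hmeas' L le_rfl hLc.isClosed.measurableSet]
    exact ENNReal.mul_pos hc0.ne' hLpos.ne'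
  · intro A hA
    constructor
    · intro h0
      have hsub : A ⊆ toMeasurable volume A ∩ L := subset_inter (subset_toMeasurable _ _) hA
      have h1 : (volume : Measure unitInterval) (toMeasurable volume A ∩ L) = 0 :=
        measure_mono_null inter_subset_left (by rw [measure_toMeasurable, h0])
      refine measure_mono_null (image_mono (image_mono (preimage_mono hsub))) ?_
      rw [hmeas' _ inter_subset_right
        ((measurableSet_toMeasurable _ _).inter hLc.isClosed.measurableSet), h1, mul_zero]
    · intro h0
      set N := toMeasurable μ (Subtype.val '' (g '' (Subtype.val ⁻¹' A))) with hN
      have hNm : MeasurableSet N := measurableSet_toMeasurable _ _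
      have hN0 : μ N = 0 := by rw [hN, measure_toMeasurable, h0]
      have hLm : MeasurableSet L := hLc.isClosed.measurableSet
      have hPm : MeasurableSet (Subtype.val '' ((fun l : L => (e l : X)) ⁻¹' N)) :=
        hLm.subtype_image
          ((continuous_subtype_val.comp e.continuous).measurable hNm)
      have hPL : Subtype.val '' ((fun l : L => (e l : X)) ⁻¹' N) ⊆ L := by
        rintro _ ⟨l, -, rfl⟩; exact l.2
      have h2 := hmeas _ hPL hPm
      have h3 : μ (Subtype.val '' (e '' (Subtype.val ⁻¹'
          (Subtype.val '' ((fun l : L => (e l : X)) ⁻¹' N))))) = 0 := by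
        refine measure_mono_null ?_ hN0
        rintro _ ⟨_, ⟨l, ⟨l', hl', hll⟩, rfl⟩, rfl⟩
        rw [← Subtype.ext hll]
        exact hl'
      rw [h3] at h2
      have h4 := (mul_eq_zero.1 h2.symm).resolve_left hc0.ne'
      refine measure_mono_null ?_ h4
      intro l hl
      refine ⟨⟨l, hA hl⟩, ?_, rfl⟩
      apply subset_toMeasurable
      rw [himg A hA]
      exact ⟨_, ⟨⟨l, hA hl⟩, hl, rfl⟩, rfl⟩
end

section
/- Every Borel set B ⊆ [0,1]² with B ∉ J_f(H¹) contains a Borel set C with C ∉ J_f(H¹) and H¹(C) = 0. -/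
open MeasureTheory Topology Filter Set ENNReal

/-- `J_f(μ)`: Borel sets coverable by countably many compact sets of finite `μ`-measure. -/
def Jfin {X : Type*} [TopologicalSpace X] [MeasurableSpace X] (μ : Measure X) :
    Set (Set X) :=
  {A | MeasurableSet A ∧
    ∃ K : ℕ → Set X, (∀ n, IsCompact (K n) ∧ μ (K n) < ⊤) ∧ A ⊆ ⋃ n, K n}

/-- The Euclidean square `[0,1]²`, as a subspace of the Euclidean plane. -/
def SqSet : Set (EuclideanSpace ℝ (Fin 2)) := {x | ∀ i, x i ∈ Set.Icc (0 : ℝ) 1}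

/-- Coverable by countably many compact sets of finite measure. -/
def Cov {X : Type*} [TopologicalSpace X] [MeasurableSpace X] (μ : Measure X) (A : Set X) : Prop :=
  ∃ K : ℕ → Set X, (∀ n, IsCompact (K n) ∧ μ (K n) < ⊤) ∧ A ⊆ ⋃ n, K n

lemma Cov.mono {X : Type*} [TopologicalSpace X] [MeasurableSpace X] {μ : Measure X}
    {A A' : Set X} (h : Cov μ A') (hA : A ⊆ A') : Cov μ A := by
  obtain ⟨K, hK, h⟩ := h
  exact ⟨K, hK, hA.trans h⟩

lemma Cov.iUnion_nat {X : Type*} [TopologicalSpace X] [MeasurableSpace X] {μ : Measure X}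
    {A : ℕ → Set X} (h : ∀ n, Cov μ (A n)) : Cov μ (⋃ n, A n) := by
  choose K hK hA using h
  refine ⟨fun n => K (Nat.unpair n).1 (Nat.unpair n).2, fun n => hK _ _, ?_⟩
  refine iUnion_subset fun n x hx => ?_
  obtain ⟨m, hm⟩ := mem_iUnion.1 (hA n hx)
  refine mem_iUnion.2 ⟨Nat.pair n m, ?_⟩
  simpa using hm

lemma Cov.empty {X : Type*} [TopologicalSpace X] [MeasurableSpace X] {μ : Measure X} :
    Cov μ (∅ : Set X) := ⟨fun _ => ∅, by simp, by simp⟩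

lemma Cov.union {X : Type*} [TopologicalSpace X] [MeasurableSpace X] {μ : Measure X}
    {A A' : Set X} (h : Cov μ A) (h' : Cov μ A') : Cov μ (A ∪ A') := by
  have := Cov.iUnion_nat (μ := μ) (A := fun n => if n = 0 then A else A')
    (fun n => by by_cases hn : n = 0 <;> simp [hn, h, h'])
  refine this.mono (union_subset (fun x hx => mem_iUnion.2 ⟨0, by simpa using hx⟩)
    (fun x hx => mem_iUnion.2 ⟨1, by simpa using hx⟩))

lemma exists_kernel {X Y : Type*} [TopologicalSpace X] [MeasurableSpace X] {μ : Measure X}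
    [TopologicalSpace Y] [SecondCountableTopology Y] (f : Y → X) (hf : ¬ Cov μ (range f)) :
    ∃ P : Set Y, IsClosed P ∧ P.Nonempty ∧
      ∀ V : Set Y, IsOpen V → (P ∩ V).Nonempty → ¬ Cov μ (f '' (P ∩ V)) := by
  obtain ⟨T, hTc, hTS, hT⟩ := TopologicalSpace.isOpen_sUnion_countable
    {V : Set Y | IsOpen V ∧ Cov μ (f '' V)} (fun s hs => hs.1)
  set U := ⋃₀ {V : Set Y | IsOpen V ∧ Cov μ (f '' V)} with hU
  have hUc : Cov μ (f '' U) := by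
    rw [← hT]
    rcases T.eq_empty_or_nonempty with rfl | hne
    · simpa using Cov.empty
    · obtain ⟨g, rfl⟩ := hTc.exists_eq_range hne
      rw [sUnion_range, image_iUnion]
      exact Cov.iUnion_nat fun n => (hTS ⟨n, rfl⟩).2
  refine ⟨Uᶜ, (isOpen_sUnion fun s hs => hs.1).isClosed_compl, ?_, ?_⟩
  · by_contra hne
    rw [not_nonempty_iff_eq_empty, compl_empty_iff] at hne
    rw [hne, image_univ] at hUc
    exact hf hUc
  · rintro V hV ⟨x, hxU, hxV⟩ hc
    refine hxU (mem_sUnion.2 ⟨V, ⟨hV, (hc.union hUc).mono ?_⟩, hxV⟩)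
    rw [← image_union]
    refine image_mono fun y hy => ?_
    by_cases h : y ∈ U
    · exact Or.inr h
    · exact Or.inl ⟨h, hy⟩

lemma exists_null_Gdelta {X : Type*} [MetricSpace X] [MeasurableSpace X] [BorelSpace X]
    (d : ℕ → X) : ∃ G : Set X, IsGδ G ∧ (∀ k, d k ∈ G) ∧ (μH[1] : Measure X) G = 0 := by
  let r : ℕ → ℕ → ℝ≥0∞ := fun n k => (2⁻¹ : ℝ≥0∞) ^ n * 2⁻¹ ^ k
  have hr0 : ∀ n k, 0 < r n k := fun n k =>
    ENNReal.mul_pos (pow_ne_zero _ (by simp)) (pow_ne_zero _ (by simp))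
  let U : ℕ → Set X := fun n => ⋃ k, Metric.eball (d k) (r n k)
  have hlim : Tendsto (fun n : ℕ => (4 : ℝ≥0∞) * (2⁻¹ : ℝ≥0∞) ^ n) atTop (𝓝 0) := by
    have := ENNReal.Tendsto.const_mul (a := 4)
      (ENNReal.tendsto_pow_atTop_nhds_zero_of_lt_one (r := 2⁻¹) (by simp)) (Or.inr (by simp))
    simpa using this
  refine ⟨⋂ n, U n, IsGδ.iInter fun n => (isOpen_iUnion fun k => Metric.isOpen_eball).isGδ,
    fun k => mem_iInter.2 fun n => mem_iUnion.2 ⟨k, Metric.mem_eball_self (hr0 n k)⟩, ?_⟩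
  have hd : ∀ n k, Metric.ediam (Metric.eball (d k) (r n k)) ≤ 2 * r n k :=
    fun n k => Metric.ediam_eball_le
  have key := Measure.hausdorffMeasure_le_liminf_tsum (X := X) (β := ℕ) (ι := fun _ => ℕ) 1
    (⋂ n, U n) (l := atTop) (fun n => (4 : ℝ≥0∞) * (2⁻¹ : ℝ≥0∞) ^ n) hlim
    (fun n k => Metric.eball (d k) (r n k))
    (Eventually.of_forall fun n k => (hd n k).trans (by
      have h1 : (2⁻¹ : ℝ≥0∞) ^ k ≤ 1 := pow_le_one₀ (by simp) (by simp)
      calc 2 * r n k ≤ 4 * (2⁻¹ ^ n * 1) := by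
            gcongr
            · norm_num
            · exact mul_le_mul_right h1 _
        _ = _ := by rw [mul_one]))
    (Eventually.of_forall fun n => iInter_subset _ n)
  refine le_antisymm (key.trans ?_) bot_le
  rw [← hlim.liminf_eq]
  refine liminf_le_liminf (Eventually.of_forall fun n => ?_)
  calc ∑' k, Metric.ediam (Metric.eball (d k) (r n k)) ^ (1 : ℝ)
      ≤ ∑' k, 2 * (2⁻¹ ^ n * 2⁻¹ ^ k) := by
        refine ENNReal.tsum_le_tsum fun k => ?_
        rw [ENNReal.rpow_one]
        exact hd n k
    _ = 4 * 2⁻¹ ^ n := by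
        rw [ENNReal.tsum_mul_left, ENNReal.tsum_mul_left, ENNReal.tsum_geometric,
          ENNReal.one_sub_inv_two, inv_inv]
        ring

lemma main_aux {X : Type*} [MetricSpace X] [PolishSpace X] [MeasurableSpace X] [BorelSpace X]
    (B : Set X) (hB : MeasurableSet B) (hn : ¬ Cov (μH[1] : Measure X) B) :
    ∃ C ⊆ B, MeasurableSet C ∧ ¬ Cov (μH[1] : Measure X) C ∧ (μH[1] : Measure X) C = 0 := by
  obtain ⟨Y, tY, pY, f, hfc, hfi, rfl⟩ : ∃ (Y : Type _) (_ : TopologicalSpace Y)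
      (_ : PolishSpace Y) (f : Y → X), Continuous f ∧ Function.Injective f ∧ range f = B := by
    obtain ⟨t', hle, hp, hcl, -⟩ := hB.isClopenable
    refine ⟨B, @instTopologicalSpaceSubtype X _ t', @IsClosed.polishSpace X t' hp B hcl,
      Subtype.val, ?_, Subtype.val_injective, Subtype.range_val⟩
    exact continuous_le_rng hle (@continuous_subtype_val X t' (· ∈ B))
  obtain ⟨P, hPc, hPne, hP⟩ := exists_kernel f hn
  have : PolishSpace P := hPc.polishSpace
  have : Nonempty P := hPne.to_subtype
  let g : P → X := fun p => f p
  have hg : Continuous g := hfc.comp continuous_subtype_val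
  have hgi : Function.Injective g := hfi.comp Subtype.val_injective
  obtain ⟨G, hG, hdG, hG0⟩ := exists_null_Gdelta (fun k => g (TopologicalSpace.denseSeq P k))
  have hGd : IsGδ (g ⁻¹' G) := hG.preimage hg
  have hdense : Dense (g ⁻¹' G) := (TopologicalSpace.denseRange_denseSeq P).mono
    (by rintro _ ⟨k, rfl⟩; exact hdG k)
  refine ⟨g '' (g ⁻¹' G), ?_, ?_, ?_, measure_mono_null (image_preimage_subset _ _) hG0⟩
  · rintro _ ⟨p, -, rfl⟩
    exact ⟨p, rfl⟩
  · let mP : MeasurableSpace P := borel P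
    have : BorelSpace P := ⟨rfl⟩
    exact hGd.measurableSet.image_of_continuousOn_injOn hg.continuousOn hgi.injOn
  · rintro ⟨K, hK, hcov⟩
    have hd := hGd.dense_iUnion_interior_of_closed hdense
      (f := fun n => g ⁻¹' (K n)) (fun n => (hK n).1.isClosed.preimage hg)
      (by rw [← preimage_iUnion]; exact image_subset_iff.1 hcov)
    obtain ⟨p, hp⟩ := hd.nonempty
    obtain ⟨n, hp⟩ := mem_iUnion.1 hp
    obtain ⟨V, hV, hVe⟩ := isOpen_induced_iff.1 (isOpen_interior (s := g ⁻¹' (K n)))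
    refine hP V hV ⟨p, p.2, ?_⟩ ⟨fun _ => K n, fun _ => hK n, ?_⟩
    · rw [← hVe] at hp
      exact hp
    · rintro _ ⟨y, ⟨hyP, hyV⟩, rfl⟩
      have : (⟨y, hyP⟩ : P) ∈ interior (g ⁻¹' (K n)) := by
        rw [← hVe]; exact hyV
      exact mem_iUnion.2 ⟨0, interior_subset (s := g ⁻¹' (K n)) this⟩

/-- Remark 6.7: every Borel set `B ⊆ [0,1]²` with `B ∉ J_f(H¹)` contains a Borel set
`C ∉ J_f(H¹)` with `H¹(C) = 0`. -/
theorem statement14 :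
    ∀ B : Set SqSet, MeasurableSet B → B ∉ Jfin (μH[1] : Measure SqSet) →
      ∃ C ⊆ B, MeasurableSet C ∧ C ∉ Jfin (μH[1] : Measure SqSet) ∧
        (μH[1] : Measure SqSet) C = 0 := by
  intro B hB hn
  have hcl : IsClosed SqSet := by
    have : SqSet = ⋂ i : Fin 2, (fun x : EuclideanSpace ℝ (Fin 2) => x i) ⁻¹' Icc (0 : ℝ) 1 := by
      ext x; simp [SqSet]
    rw [this]
    exact isClosed_iInter fun i => isClosed_Icc.preimage (by fun_prop)
  have : PolishSpace SqSet := hcl.polishSpace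
  obtain ⟨C, hC, hCm, hCn, hC0⟩ := main_aux B hB (fun h => hn ⟨hB, h⟩)
  exact ⟨C, hC, hCm, fun h => hCn h.2, hC0⟩
end

section
/- Let μ be a nonatomic Borel measure on a compactum X such that every Borel set B ∉ J_f(μ) contains a Borel set C ∉ J_f(μ) with μ(C) < ∞. Then for every Borel set B ⊆ X with B ∉ J_f(μ) there is a function φ : 2^ℕ → Bor(X) such that for every c ∈ 2^ℕ, φ(c) is a Borel subset of B with φ(c) ∉ J_f(μ), and φ(c) ∩ φ(d) = ∅ for all distinct c, d ∈ 2^ℕ. -/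
open MeasureTheory Topology Filter Set ENNReal

/-- Coverability by countably many compact sets of finite measure. -/
def Cov15 {X : Type*} [TopologicalSpace X] [MeasurableSpace X] (μ : Measure X)
    (A : Set X) : Prop :=
  ∃ K : ℕ → Set X, (∀ n, IsCompact (K n) ∧ μ (K n) < ⊤) ∧ A ⊆ ⋃ n, K n

section
variable {X : Type*} [TopologicalSpace X] [MeasurableSpace X] {μ : Measure X}

lemma Cov15.mono {A B : Set X} (h : A ⊆ B) (hB : Cov15 μ B) : Cov15 μ A := by
  obtain ⟨K, hK, hs⟩ := hB
  exact ⟨K, hK, h.trans hs⟩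

lemma Cov15.of_compact {A : Set X} (h : IsCompact A) (hA : μ A < ⊤) : Cov15 μ A :=
  ⟨fun _ => A, fun _ => ⟨h, hA⟩, subset_iUnion (fun _ : ℕ => A) 0⟩

lemma Cov15.empty : Cov15 μ (∅ : Set X) :=
  Cov15.of_compact isCompact_empty (by simp)

lemma Cov15.iUnion {A : ℕ → Set X} (h : ∀ n, Cov15 μ (A n)) : Cov15 μ (⋃ n, A n) := by
  choose K hK hs using h
  refine ⟨fun n => K n.unpair.1 n.unpair.2, fun n => hK _ _, ?_⟩
  refine iUnion_subset fun n x hx => ?_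
  obtain ⟨m, hm⟩ := mem_iUnion.1 (hs n hx)
  exact mem_iUnion.2 ⟨Nat.pair n m, by simpa using hm⟩

lemma Cov15.sUnion {S : Set (Set X)} (hS : S.Countable) (h : ∀ A ∈ S, Cov15 μ A) :
    Cov15 μ (⋃₀ S) := by
  rcases S.eq_empty_or_nonempty with rfl | hne
  · simpa using Cov15.empty
  · obtain ⟨f, rfl⟩ := hS.exists_eq_range hne
    rw [sUnion_range]
    exact Cov15.iUnion fun n => h _ (mem_range_self n)

lemma Cov15.union {A B : Set X} (hA : Cov15 μ A) (hB : Cov15 μ B) : Cov15 μ (A ∪ B) := by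
  rw [← sUnion_pair]
  refine Cov15.sUnion (by simp) ?_
  rintro C (rfl | rfl) <;> assumption

/-- Meagre sets when closed nowhere dense sets have small measure. -/
lemma meagre_cover15 (h : ∀ E : Set X, IsClosed E → Dense Eᶜ → μ E < 1) {s : Set X}
    (hs : IsMeagre s) :
    ∃ E : ℕ → Set X, (∀ n, IsClosed (E n)) ∧ (∀ n, μ (E n) < 1) ∧ s ⊆ ⋃ n, E n ∧
      μ (⋃ n, E n) ≤ 1 := by
  obtain ⟨S, hS, hc, hsub⟩ := isMeagre_iff_countable_union_isNowhereDense.1 hs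
  obtain ⟨f, hf⟩ : ∃ f : ℕ → Set X, (∀ n, IsNowhereDense (f n)) ∧ s ⊆ ⋃ n, f n := by
    rcases S.eq_empty_or_nonempty with rfl | hne
    · exact ⟨fun _ => ∅, fun _ => isNowhereDense_empty, by simpa using hsub⟩
    · obtain ⟨f, rfl⟩ := hc.exists_eq_range hne
      exact ⟨f, fun n => hS _ (mem_range_self n), by simpa using hsub⟩
  set E : ℕ → Set X := accumulate (fun n => closure (f n)) with hE
  have key : ∀ n, IsClosed (E n) ∧ Dense (E n)ᶜ := by
    have hcl : ∀ n, IsClosed (closure (f n)) ∧ IsNowhereDense (closure (f n)) :=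
      fun n => ⟨isClosed_closure, (hf.1 n).closure⟩
    have hcl' : ∀ n, IsOpen (closure (f n))ᶜ ∧ Dense (closure (f n))ᶜ :=
      fun n => isClosed_isNowhereDense_iff_compl.1 (hcl n)
    intro n
    induction n with
    | zero => simpa [hE, accumulate_zero_nat] using (hcl' 0).2
    | succ n ih =>
      rw [hE, accumulate_succ]
      refine ⟨ih.1.union isClosed_closure, ?_⟩
      rw [compl_union]
      exact ih.2.inter_of_isOpen_right (hcl' (n+1)).2 (hcl' (n+1)).1
  refine ⟨E, fun n => (key n).1, fun n => h _ (key n).1 (key n).2, ?_, ?_⟩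
  · rw [hE, iUnion_accumulate]
    exact hf.2.trans (iUnion_mono fun n => subset_closure)
  · rw [hE, iUnion_accumulate, measure_iUnion_eq_iSup_accumulate]
    exact iSup_le fun n => (h _ (key n).1 (key n).2).le
end

/-- Existence of a large set `L`, nowhere dense in the closure. -/
lemma exists_L15 {X Z : Type*} [MetricSpace X] [CompactSpace X] [MeasurableSpace X] [BorelSpace X]
    [TopologicalSpace Z] (μ : Measure X) (B : Set X) (hB : MeasurableSet B) (hB0 : μ B = 0)
    (f : Z → X) (hf : Continuous f) (hfB : ∀ z, f z ∈ B)
    (hZ : ∀ W : Set Z, IsOpen W → W.Nonempty → ¬ Cov15 μ (f '' W))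
    (W : Set Z) (hW : IsOpen W) (hne : W.Nonempty) :
    ∃ L : Set X, IsClosed L ∧ L ⊆ closure (f '' W \ L) ∧ 1 ≤ μ L := by
  by_contra hcon
  push Not at hcon
  set F : Set X := closure (f '' W) with hF
  have hFc : IsClosed F := isClosed_closure
  have hFm : MeasurableSet F := hFc.measurableSet
  have hval : ∀ s : Set F, (μ.comap Subtype.val) s = μ (Subtype.val '' s) :=
    fun s => (MeasurableEmbedding.subtype_coe hFm).comap_apply μ s
  have hdense : Dense ((Subtype.val : F → X) ⁻¹' (f '' W)) := by
    rw [Subtype.dense_iff]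
    intro x hx
    rwa [Subtype.image_preimage_coe, inter_eq_right.2 subset_closure]
  have small : ∀ E : Set F, IsClosed E → Dense Eᶜ → (μ.comap Subtype.val) E < 1 := by
    intro E hE hd
    rw [hval]
    refine hcon _ (hFc.isClosedEmbedding_subtypeVal.isClosedMap _ hE) ?_
    have h1 := hdense.inter_of_isOpen_right hd hE.isOpen_compl
    rintro _ ⟨x, hx, rfl⟩
    have h2 := image_closure_subset_closure_image (continuous_subtype_val (p := (· ∈ F)))
      (mem_image_of_mem _ (h1 x))
    refine closure_mono ?_ h2
    rintro _ ⟨y, ⟨hy1, hy2⟩, rfl⟩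
    refine ⟨hy1, ?_⟩
    rintro ⟨y', hy', e⟩
    exact hy2 (Subtype.ext e ▸ hy')
  obtain ⟨O, hO, hOe⟩ := (measurable_subtype_coe hB : MeasurableSet
    ((Subtype.val : F → X) ⁻¹' B)).residualEq_isOpen
  have hOe' : ∀ᶠ x in residual F, (x ∈ (Subtype.val : F → X) ⁻¹' B ↔ x ∈ O) :=
    Filter.eventuallyEq_set.1 hOe
  have hm : IsMeagre {x : F | ¬ (x ∈ (Subtype.val : F → X) ⁻¹' B ↔ x ∈ O)} := by
    rw [IsMeagre]
    exact mem_of_superset hOe' fun x hx h => h hx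
  obtain ⟨E, hEc, hE1, hEs, hEm⟩ := meagre_cover15 small hm
  have hEcov : ∀ n, Cov15 μ (Subtype.val '' E n) := fun n =>
    Cov15.of_compact (hFc.isClosedEmbedding_subtypeVal.isClosedMap _ (hEc n)).isCompact
      (by rw [← hval]; exact (hE1 n).trans ENNReal.one_lt_top)
  rcases O.eq_empty_or_nonempty with rfl | ⟨o, ho⟩
  · refine hZ W hW hne ((Cov15.iUnion hEcov).mono ?_)
    rintro _ ⟨w, hw, rfl⟩
    have : (⟨f w, subset_closure (mem_image_of_mem f hw)⟩ : F) ∈ ⋃ n, E n :=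
      hEs (by simp [hfB])
    obtain ⟨n, hn⟩ := mem_iUnion.1 this
    exact mem_iUnion.2 ⟨n, _, hn, rfl⟩
  · obtain ⟨V, hV, rfl⟩ := isOpen_induced_iff.1 hO
    obtain ⟨N, hN, hNc, hNV⟩ := exists_mem_nhds_isClosed_subset (hV.mem_nhds ho)
    obtain ⟨_, hy1, w, hw, rfl⟩ := mem_closure_iff.1 o.2 _ isOpen_interior
      (mem_interior_iff_mem_nhds.2 hN)
    refine hZ (W ∩ f ⁻¹' interior N) (hW.inter (isOpen_interior.preimage hf)) ⟨w, hw, hy1⟩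
      ((Cov15.of_compact (hNc.inter hFc).isCompact ?_).mono ?_)
    · have : N ∩ F ⊆ B ∪ Subtype.val '' (⋃ n, E n) := by
        rintro x ⟨hxN, hxF⟩
        by_cases hxB : x ∈ B
        · exact Or.inl hxB
        · exact Or.inr ⟨⟨x, hxF⟩, hEs (by simp [hxB, hNV hxN]), rfl⟩
      calc μ (N ∩ F) ≤ μ B + μ (Subtype.val '' (⋃ n, E n)) :=
            (measure_mono this).trans (measure_union_le _ _)
        _ ≤ 0 + 1 := by rw [hB0, ← hval]; gcongr
        _ < ⊤ := by simp
    · rintro _ ⟨w, ⟨hw, hwN⟩, rfl⟩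
      exact ⟨interior_subset hwN, subset_closure (mem_image_of_mem f hw)⟩

/-- One step of the scheme. -/
lemma step15 {X Z : Type*} [MetricSpace X] [CompactSpace X] [MeasurableSpace X] [BorelSpace X]
    [MetricSpace Z] (μ : Measure X) (B : Set X) (hB : MeasurableSet B) (hB0 : μ B = 0)
    (f : Z → X) (hf : Continuous f) (hfB : ∀ z, f z ∈ B)
    (hZ : ∀ W : Set Z, IsOpen W → W.Nonempty → ¬ Cov15 μ (f '' W))
    (W : Set Z) (hW : IsOpen W) (hne : W.Nonempty) (ε : ℝ) (hε : 0 < ε) :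
    ∃ (L : Set X) (V : ℕ × ℕ × Bool → Set Z), IsClosed L ∧ 1 ≤ μ L ∧ L ⊆ closure (f '' W) ∧
      (∀ i, IsOpen (V i) ∧ (V i).Nonempty ∧ closure (V i) ⊆ W ∧
        ∀ x ∈ V i, ∀ y ∈ V i, dist x y ≤ ε) ∧
      (∀ i j, i ≠ j → Disjoint (closure (f '' V i)) (closure (f '' V j))) ∧
      (∀ x ∈ L, ∀ O : Set X, IsOpen O → x ∈ O → ∀ b : Bool, ∃ n m,
        closure (f '' V (n, m, b)) ⊆ O) := by
  obtain ⟨L, hLc, hLs, hL1⟩ := exists_L15 μ B hB hB0 f hf hfB hZ W hW hne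
  have hLne : L.Nonempty := by
    rw [nonempty_iff_ne_empty]; rintro rfl; simp at hL1
  have : Nonempty L := hLne.to_subtype
  -- choice step
  have ex : ∀ (C : {C : Set X // IsClosed C ∧ Disjoint C L}) (x : L) (r : ℝ), 0 < r →
      ∃ V : Set Z, IsOpen V ∧ V.Nonempty ∧ closure V ⊆ W ∧
        (∀ x ∈ V, ∀ y ∈ V, dist x y ≤ ε) ∧
        closure (f '' V) ⊆ Metric.ball (x : X) r ∧ Disjoint (closure (f '' V)) C.1 ∧
        Disjoint (closure (f '' V)) L := by
    rintro ⟨C, hC, hCL⟩ x r hr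
    have hxC : (x : X) ∈ Cᶜ := fun h => hCL.ne_of_mem h x.2 rfl
    obtain ⟨_, ⟨hy1, hy2⟩, ⟨w, hw, rfl⟩, hy4⟩ := mem_closure_iff.1 (hLs x.2) _
      (Metric.isOpen_ball.inter hC.isOpen_compl) ⟨Metric.mem_ball_self hr, hxC⟩
    obtain ⟨N, hN, hNc, hNV⟩ := exists_mem_nhds_isClosed_subset
      (((Metric.isOpen_ball.inter hC.isOpen_compl).inter hLc.isOpen_compl).mem_nhds
        (show f w ∈ (Metric.ball (x : X) r ∩ Cᶜ) ∩ Lᶜ from ⟨⟨hy1, hy2⟩, hy4⟩))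
    obtain ⟨δ, hδ, hδs⟩ := Metric.nhds_basis_closedBall.mem_iff.1
      (inter_mem (hW.mem_nhds hw) (hf.continuousAt.preimage_mem_nhds hN))
    have hcN : closure (f '' Metric.ball w (min δ (ε / 2))) ⊆ N := by
      refine closure_minimal ?_ hNc
      rintro _ ⟨z, hz, rfl⟩
      exact (hδs (Metric.mem_closedBall.2
        ((Metric.mem_ball.1 hz).le.trans (min_le_left _ _)))).2
    refine ⟨Metric.ball w (min δ (ε / 2)), Metric.isOpen_ball,
      ⟨w, Metric.mem_ball_self (by positivity)⟩, ?_, ?_, ?_, ?_, ?_⟩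
    · exact Metric.closure_ball_subset_closedBall.trans
        ((Metric.closedBall_subset_closedBall (min_le_left _ _)).trans
          (hδs.trans inter_subset_left))
    · intro a ha b hb
      have h1 := (Metric.mem_ball.1 ha).trans_le (min_le_right _ _)
      have h2 := (Metric.mem_ball.1 hb).trans_le (min_le_right _ _)
      have := dist_triangle_right a b w
      linarith
    · exact fun y hy => (hNV (hcN hy)).1.1
    · exact disjoint_left.2 fun y hy => (hNV (hcN hy)).1.2
    · exact disjoint_left.2 fun y hy => (hNV (hcN hy)).2
  choose! g hg1 hg2 hg3 hg4 hg5 hg6 hg7 using ex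
  obtain ⟨e⟩ : Nonempty (ℕ ≃ ℕ × ℕ × Bool) := nonempty_equiv_of_countable
  let x : ℕ → L := fun n => TopologicalSpace.denseSeq L (e n).1
  let r : ℕ → ℝ := fun n => 1 / ((e n).2.1 + 1 : ℝ)
  have hr : ∀ n, 0 < r n := fun n => by positivity
  let s : ℕ → {C : Set X // IsClosed C ∧ Disjoint C L} := fun n => Nat.rec
    ⟨∅, isClosed_empty, by simp⟩
    (fun n C => ⟨C.1 ∪ closure (f '' g C (x n) (r n)), C.2.1.union isClosed_closure,
      C.2.2.union_left (hg7 C (x n) (r n) (hr n))⟩) n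
  have hs : ∀ n, (s (n+1)).1 = (s n).1 ∪ closure (f '' g (s n) (x n) (r n)) := fun n => rfl
  let V : ℕ → Set Z := fun n => g (s n) (x n) (r n)
  have hmono : Monotone fun n => (s n).1 :=
    monotone_nat_of_le_succ fun n => by rw [hs]; exact subset_union_left
  have hdis : ∀ i j, i < j → Disjoint (closure (f '' V i)) (closure (f '' V j)) := by
    intro i j hij
    refine ((hg6 (s j) (x j) (r j) (hr j)).mono_right ?_).symm
    exact (show closure (f '' V i) ⊆ (s (i+1)).1 by
      rw [hs]; exact subset_union_right).trans (hmono (Nat.succ_le_of_lt hij))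
  refine ⟨L, fun i => V (e.symm i), hLc, hL1, hLs.trans (closure_mono sdiff_subset), ?_, ?_, ?_⟩
  · intro i
    exact ⟨hg1 _ _ _ (hr _), hg2 _ _ _ (hr _), hg3 _ _ _ (hr _), hg4 _ _ _ (hr _)⟩
  · intro i j hij
    rcases lt_or_gt_of_ne (e.symm.injective.ne hij) with h | h
    · exact hdis _ _ h
    · exact (hdis _ _ h).symm
  · intro y hy O hO hyO b
    obtain ⟨ρ, hρ, hρs⟩ := Metric.isOpen_iff.1 hO y hyO
    obtain ⟨m, hm⟩ := exists_nat_one_div_lt (half_pos hρ)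
    obtain ⟨n, hn⟩ := (TopologicalSpace.denseRange_denseSeq L).exists_dist_lt ⟨y, hy⟩
      (half_pos hρ)
    refine ⟨n, m, (hg5 _ _ _ (hr _)).trans (Subset.trans ?_ hρs)⟩
    intro z hz
    have h1 : dist z (TopologicalSpace.denseSeq L n : X) < 1 / ((m : ℝ) + 1) := by
      simpa [x, r] using hz
    have h2 : dist y (TopologicalSpace.denseSeq L n : X) < ρ / 2 := hn
    rw [Metric.mem_ball]
    have := dist_triangle_right z y (TopologicalSpace.denseSeq L n : X)
    linarith

/-- Compatibility of a node (most recent entry first) with a branch `c`. -/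
def compat15 (c : ℕ → Bool) : List (ℕ × ℕ × Bool) → Prop
  | [] => True
  | i :: u => i.2.2 = c u.length ∧ compat15 c u

lemma compat15_eq {c d : ℕ → Bool} : ∀ {u : List (ℕ × ℕ × Bool)}, compat15 c u → compat15 d u →
    ∀ k < u.length, c k = d k
  | [], _, _, k, hk => by simp at hk
  | i :: u, h1, h2, k, hk => by
    rcases Nat.lt_succ_iff_lt_or_eq.1 (by simpa using hk : k < u.length + 1) with h | h
    · exact compat15_eq h1.2 h2.2 k h
    · rw [h, ← h1.1, h2.1]

lemma main15 {X Z : Type*} [MetricSpace X] [CompactSpace X] [MeasurableSpace X] [BorelSpace X]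
    [MetricSpace Z] [CompleteSpace Z] [SecondCountableTopology Z] [Nonempty Z]
    (μ : Measure X) (B : Set X) (hB : MeasurableSet B) (hB0 : μ B = 0)
    (f : Z → X) (hf : Continuous f) (hfB : ∀ z, f z ∈ B)
    (hZ : ∀ W : Set Z, IsOpen W → W.Nonempty → ¬ Cov15 μ (f '' W)) :
    ∃ φ : (ℕ → Bool) → Set X,
        (∀ c : ℕ → Bool, φ c ⊆ B ∧ MeasurableSet (φ c) ∧ ¬ Cov15 μ (φ c)) ∧
        ∀ c d : ℕ → Bool, c ≠ d → φ c ∩ φ d = ∅ := by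
  have st : ∀ (W : {W : Set Z // IsOpen W ∧ W.Nonempty}) (k : ℕ), _ := fun W k =>
    step15 μ B hB hB0 f hf hfB hZ W.1 W.2.1 W.2.2 ((1/2 : ℝ)^k) (by positivity)
  choose L V hLc hL1 hLs hV hVd hVL using st
  let T : List (ℕ × ℕ × Bool) → {W : Set Z // IsOpen W ∧ W.Nonempty} := fun u =>
    List.rec ⟨univ, isOpen_univ, univ_nonempty⟩
      (fun i u W => ⟨V W u.length i, (hV W u.length i).1, (hV W u.length i).2.1⟩) u
  have hT : ∀ i u, (T (i :: u)).1 = V (T u) u.length i := fun i u => rfl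
  have hTc : ∀ i u, closure (T (i :: u)).1 ⊆ (T u).1 := fun i u => by
    rw [hT]; exact (hV (T u) u.length i).2.2.1
  have hTs : ∀ i u, (T (i :: u)).1 ⊆ (T u).1 := fun i u => subset_closure.trans (hTc i u)
  have hTdist : ∀ i u, ∀ x ∈ (T (i :: u)).1, ∀ y ∈ (T (i :: u)).1,
      dist x y ≤ (1/2 : ℝ)^u.length := fun i u => by
    rw [hT]; exact (hV (T u) u.length i).2.2.2
  have huniq : ∀ u v : List (ℕ × ℕ × Bool), u.length = v.length → ∀ x,
      x ∈ closure (f '' (T u).1) → x ∈ closure (f '' (T v).1) → u = v := by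
    intro u
    induction u with
    | nil => intro v hv x _ _; exact (List.length_eq_zero_iff.1 hv.symm).symm
    | cons i u ih =>
      intro v hv x hx hx'
      cases v with
      | nil => simp at hv
      | cons j v =>
        have huv : u = v := ih v (by simpa using hv) x
          (closure_mono (image_mono (hTs i u)) hx) (closure_mono (image_mono (hTs j v)) hx')
        subst huv
        by_contra hne
        have hij : i ≠ j := fun h => hne (by rw [h])
        exact (hVd (T u) u.length i j hij).ne_of_mem hx hx' rfl
  let Zc : (ℕ → Bool) → Set Z := fun c =>
    ⋂ k : ℕ, ⋃ u ∈ {u : List (ℕ × ℕ × Bool) | u.length = k ∧ compat15 c u}, (T u).1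
  have hZc : ∀ c z, z ∈ Zc c ↔ ∀ k, ∃ u, (u.length = k ∧ compat15 c u) ∧ z ∈ (T u).1 := by
    intro c z; simp [Zc]
  have himg : ∀ z u, z ∈ (T u).1 → f z ∈ closure (f '' (T u).1) :=
    fun z u h => subset_closure (mem_image_of_mem f h)
  refine ⟨fun c => f '' Zc c, fun c => ⟨?_, ?_, ?_⟩, ?_⟩
  · rintro _ ⟨z, _, rfl⟩; exact hfB z
  · borelize Z
    refine MeasurableSet.image_of_continuousOn_injOn ?_ hf.continuousOn ?_
    · refine MeasurableSet.iInter fun k => MeasurableSet.biUnion (to_countable _) fun u _ =>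
        (T u).2.1.measurableSet
    · intro z hz z' hz' he
      rw [hZc] at hz hz'
      refine dist_le_zero.1 ?_
      refine ge_of_tendsto' (tendsto_pow_atTop_nhds_zero_of_lt_one (r := (1/2 : ℝ))
        (by norm_num) (by norm_num)) fun k => ?_
      obtain ⟨u, ⟨hu, -⟩, hzu⟩ := hz (k+1)
      obtain ⟨v, ⟨hv, -⟩, hzv⟩ := hz' (k+1)
      have := huniq u v (hu.trans hv.symm) (f z) (himg _ _ hzu) (he ▸ himg _ _ hzv)
      subst this
      cases u with
      | nil => simp at hu
      | cons i u =>
        have h := hTdist i u z hzu z' hzv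
        rwa [show u.length = k by simpa using hu] at h
  · rintro ⟨K, hK, hsub⟩
    have ext : ∀ (u : {u // compat15 c u}) (m : ℕ), ∃ v : {u // compat15 c u},
        u.1.length < v.1.length ∧ closure (T v.1).1 ⊆ (T u.1).1 ∧
        Disjoint (f '' (T v.1).1) (K m) := by
      rintro ⟨u, hu⟩ m
      let i : ℕ → ℕ × ℕ × Bool := fun a => (a, 0, c u.length)
      obtain ⟨a, ha⟩ : ∃ a, ¬ L (T (i a :: u)) (u.length + 1) ⊆ K m := by
        by_contra! hall
        have hd : Pairwise (Function.onFun Disjoint fun a => L (T (i a :: u)) (u.length + 1)) := by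
          intro a b hab
          have hij : i a ≠ i b := fun h => hab (congrArg Prod.fst h)
          exact (hVd (T u) u.length _ _ hij).mono (hLs (T (i a :: u)) _) (hLs (T (i b :: u)) _)
        have h1 := measure_iUnion (μ := μ) hd fun a => (hLc _ _).measurableSet
        have h2 : (⊤ : ℝ≥0∞) ≤ ∑' a, μ (L (T (i a :: u)) (u.length + 1)) := by
          rw [← ENNReal.tsum_const_eq_top_of_ne_zero (α := ℕ) one_ne_zero]
          exact ENNReal.tsum_le_tsum fun a => hL1 _ _
        rw [← h1] at h2
        exact absurd (h2.trans (measure_mono (iUnion_subset hall))) (not_le.2 (hK m).2)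
      obtain ⟨x, hx, hxK⟩ := not_subset.1 ha
      obtain ⟨n, n', hn⟩ := hVL _ _ x hx (K m)ᶜ (hK m).1.isClosed.isOpen_compl hxK
        (c (u.length + 1))
      refine ⟨⟨(n, n', c (u.length + 1)) :: i a :: u, ?_⟩, ?_, ?_, ?_⟩
      · exact ⟨by simp, rfl, hu⟩
      · simp only [List.length_cons]; omega
      · exact (hTc _ (i a :: u)).trans (hTs (i a) u)
      · exact disjoint_left.2 fun y hy => hn (subset_closure hy)
    choose nx hnx1 hnx2 hnx3 using ext
    let v : ℕ → {u // compat15 c u} := fun m =>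
      Nat.rec ⟨[], trivial⟩ (fun m u => nx u m) m
    have hv : ∀ m, v (m+1) = nx (v m) m := fun m => rfl
    have hlen : ∀ m, m ≤ (v m).1.length := by
      intro m
      induction m with
      | zero => simp
      | succ m ih => rw [hv]; exact Nat.succ_le_of_lt (ih.trans_lt (hnx1 _ _))
    have hanti : Antitone fun m => (T (v m).1).1 := antitone_nat_of_succ_le fun m => by
      rw [hv]; exact subset_closure.trans (hnx2 _ _)
    choose z hz using fun m => (T (v m).1).2.2
    have hdist : ∀ m, ∀ x ∈ (T (v (m+1)).1).1, ∀ y ∈ (T (v (m+1)).1).1,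
        dist x y ≤ (1/2 : ℝ)^m := by
      intro m x hx y hy
      have hl := hlen (m+1)
      generalize (v (m+1)).1 = w at hx hy hl
      cases w with
      | nil => simp at hl
      | cons i u =>
        refine (hTdist i u x hx y hy).trans ?_
        exact pow_le_pow_of_le_one (by norm_num) (by norm_num) (by simpa using hl)
    have hcau : CauchySeq fun m => z (m+1) := by
      refine cauchySeq_of_le_geometric (1/2) 1 (by norm_num) fun m => ?_
      rw [one_mul]
      exact hdist m _ (hz (m+1)) _ (hanti (Nat.le_succ (m+1)) (hz (m+1+1)))
    obtain ⟨y, hy⟩ := cauchySeq_tendsto_of_complete hcau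
    have hyT : ∀ m, y ∈ (T (v m).1).1 := by
      intro m
      refine hnx2 (v m) m ?_
      rw [← hv]
      refine mem_closure_of_tendsto hy ?_
      filter_upwards [eventually_ge_atTop m] with k hk
      exact hanti (Nat.succ_le_succ hk) (hz (k+1))
    have hpre : ∀ w : List (ℕ × ℕ × Bool), compat15 c w → y ∈ (T w).1 → ∀ k ≤ w.length,
        ∃ u, (u.length = k ∧ compat15 c u) ∧ y ∈ (T u).1 := by
      intro w
      induction w with
      | nil => intro hw hyw k hk; exact ⟨[], ⟨(Nat.le_zero.1 hk).symm, hw⟩, hyw⟩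
      | cons i w ih =>
        intro hw hyw k hk
        rcases hk.eq_or_lt with h | h
        · exact ⟨i :: w, ⟨h.symm, hw⟩, hyw⟩
        · exact ih hw.2 (hTs i w hyw) k (Nat.lt_succ_iff.1 (by simpa using h))
    have hyZ : y ∈ Zc c := by
      rw [hZc]
      exact fun k => hpre _ (v k).2 (hyT k) k (hlen k)
    obtain ⟨m, hm⟩ := mem_iUnion.1 (hsub (mem_image_of_mem f hyZ))
    exact (hnx3 (v m) m).ne_of_mem (mem_image_of_mem f (hyT (m+1))) hm rfl
  · intro c d hcd
    by_contra hne
    obtain ⟨_, ⟨z, hz, rfl⟩, ⟨z', hz', he⟩⟩ := nonempty_iff_ne_empty.2 hne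
    rw [hZc] at hz hz'
    refine hcd (funext fun k => ?_)
    obtain ⟨u, ⟨hu, huc⟩, hzu⟩ := hz (k+1)
    obtain ⟨v, ⟨hv, hvc⟩, hzv⟩ := hz' (k+1)
    have := huniq u v (hu.trans hv.symm) (f z) (himg _ _ hzu) (he ▸ himg _ _ hzv)
    subst this
    exact compat15_eq huc hvc k (by omega)

/-- Passing to the kernel of a Polish parametrization. -/
lemma kernel15 {X : Type*} [MetricSpace X] [CompactSpace X] [MeasurableSpace X] [BorelSpace X]
    (μ : Measure X) (B : Set X) (hB : MeasurableSet B) (hB0 : μ B = 0) (hBc : ¬ Cov15 μ B) :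
    ∃ φ : (ℕ → Bool) → Set X,
        (∀ c : ℕ → Bool, φ c ⊆ B ∧ MeasurableSet (φ c) ∧ ¬ Cov15 μ (φ c)) ∧
        ∀ c d : ℕ → Bool, c ≠ d → φ c ∩ φ d = ∅ := by
  obtain ⟨Y, _, _, f, hf, rfl⟩ := analyticSet_iff_exists_polishSpace_range.1 hB.analyticSet
  let S : Set (Set Y) := {W | IsOpen W ∧ Cov15 μ (f '' W)}
  have hSo : IsOpen (⋃₀ S) := isOpen_sUnion fun W hW => hW.1
  obtain ⟨S', hS'c, hS's, hS'e⟩ := TopologicalSpace.isOpen_sUnion_countable S fun W hW => hW.1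
  have hScov : Cov15 μ (f '' ⋃₀ S) := by
    rw [← hS'e, image_sUnion]
    refine Cov15.sUnion (hS'c.image _) ?_
    rintro _ ⟨W, hW, rfl⟩
    exact (hS's hW).2
  have hcl : IsClosed (⋃₀ S)ᶜ := hSo.isClosed_compl
  let Z : Type := ((⋃₀ S)ᶜ : Set Y)
  have : PolishSpace ((⋃₀ S)ᶜ : Set Y) := hcl.polishSpace
  have hne : Nonempty ((⋃₀ S)ᶜ : Set Y) := by
    by_contra hemp
    have : (⋃₀ S)ᶜ = ∅ := by
      rwa [← not_nonempty_iff_eq_empty, ← nonempty_coe_sort]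
    rw [compl_empty_iff.1 this, image_univ] at hScov
    exact hBc hScov
  letI := TopologicalSpace.upgradeIsCompletelyMetrizable ((⋃₀ S)ᶜ : Set Y)
  refine main15 (Z := ((⋃₀ S)ᶜ : Set Y)) μ (range f) hB hB0 (fun z => f z)
    (hf.comp continuous_subtype_val) (fun z => mem_range_self _) ?_
  intro W hW ⟨w, hw⟩ hcov
  obtain ⟨U, hU, rfl⟩ := isOpen_induced_iff.1 hW
  refine w.2 (mem_sUnion.2 ⟨U, ⟨hU, (hcov.union hScov).mono ?_⟩, hw⟩)
  rintro _ ⟨y, hy, rfl⟩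
  by_cases h : y ∈ ⋃₀ S
  · exact Or.inr (mem_image_of_mem f h)
  · exact Or.inl ⟨⟨y, h⟩, hy, rfl⟩

/-- A Borel set of finite measure is a null set up to a coverable part. -/
lemma null15 {X : Type*} [MetricSpace X] [CompactSpace X] [MeasurableSpace X] [BorelSpace X]
    (μ : Measure X) (C : Set X) (hC : MeasurableSet C) (hCf : μ C < ⊤) (hCc : ¬ Cov15 μ C) :
    ∃ N ⊆ C, MeasurableSet N ∧ μ N = 0 ∧ ¬ Cov15 μ N := by
  have : IsFiniteMeasure (μ.restrict C) := ⟨by simpa using hCf⟩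
  have h : ∀ n : ℕ, ∃ K ⊆ C, IsCompact K ∧ (μ.restrict C) (C \ K) < ((n : ℝ≥0∞) + 1)⁻¹ :=
    fun n => hC.exists_isCompact_sdiff_lt (measure_ne_top _ _) (by simp)
  choose K hKC hK hKm using h
  have hNm : MeasurableSet (C \ ⋃ n, K n) :=
    hC.diff (MeasurableSet.iUnion fun n => (hK n).measurableSet)
  refine ⟨C \ ⋃ n, K n, sdiff_subset, hNm, ?_, fun hcov => hCc ?_⟩
  · rw [← Measure.restrict_eq_self μ (sdiff_subset : C \ (⋃ n, K n) ⊆ C)]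
    refine le_antisymm ?_ zero_le
    have ht : Tendsto (fun n : ℕ => ((n : ℝ≥0∞) + 1)⁻¹) atTop (𝓝 0) := by
      have := (tendsto_add_atTop_iff_nat 1).2 ENNReal.tendsto_inv_nat_nhds_zero
      simpa using this
    refine ge_of_tendsto' ht fun n => le_trans (measure_mono ?_) (hKm n).le
    exact sdiff_subset_sdiff_right (subset_iUnion K n)
  · refine (hcov.union (Cov15.iUnion fun n => Cov15.of_compact (hK n)
      ((measure_mono (hKC n)).trans_lt hCf))).mono ?_
    intro x hx
    by_cases h : x ∈ ⋃ n, K n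
    · exact Or.inr h
    · exact Or.inl ⟨hx, h⟩

/-- Proposition 6.8(i): under the hereditary finiteness condition on `J_f(μ)`, below every
Borel set `B ∉ J_f(μ)` there is a family, indexed by the Cantor space, of pairwise
disjoint Borel subsets of `B` not in `J_f(μ)`. -/
theorem statement15 {X : Type*}
    [MetricSpace X] [CompactSpace X] [Nonempty X] [MeasurableSpace X] [BorelSpace X]
    (μ : Measure X) (hμna : ∀ x : X, μ {x} = 0)
    (hered : ∀ B : Set X, MeasurableSet B → B ∉ Jfin μ →
      ∃ C ⊆ B, MeasurableSet C ∧ C ∉ Jfin μ ∧ μ C < ⊤) :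
    ∀ B : Set X, MeasurableSet B → B ∉ Jfin μ →
      ∃ φ : (ℕ → Bool) → Set X,
        (∀ c : ℕ → Bool, φ c ⊆ B ∧ MeasurableSet (φ c) ∧ φ c ∉ Jfin μ) ∧
        ∀ c d : ℕ → Bool, c ≠ d → φ c ∩ φ d = ∅ := by

  intro B hB hBJ
  have hJ : ∀ A : Set X, MeasurableSet A → (A ∉ Jfin μ ↔ ¬ Cov15 μ A) := fun A hA =>
    not_congr ⟨fun h => h.2, fun h => ⟨hA, h⟩⟩
  obtain ⟨C, hCB, hC, hCJ, hCf⟩ := hered B hB hBJ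
  obtain ⟨N, hNC, hN, hN0, hNc⟩ := null15 μ C hC hCf ((hJ C hC).1 hCJ)
  obtain ⟨φ, h1, h2⟩ := kernel15 μ N hN hN0 hNc
  exact ⟨φ, fun c => ⟨(h1 c).1.trans (hNC.trans hCB), (h1 c).2.1,
    (hJ _ (h1 c).2.1).2 (h1 c).2.2⟩, h2⟩
end
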